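/- arXiv:0810.4300 — 2 statements merged into one kernel-verified Lean document; each statement's English description precedes it below -/
import Mathlib

section
/- Let (X, 𝓑, μ, T) be an ergodic m.t.d.s. and 𝓤 a cover of X. Then h_μ^e(𝓤, T) = h_μ^+(𝓤, T). -/
open MeasureTheory Filter Topology
open scoped Classical

variable {X : Type*} [MeasurableSpace X]

noncomputable def cJoin (U V : Finset (Set X)) : Finset (Set X) :=
  (U ×ˢ V).image fun p => p.1 ∩ p.2

noncomputable def preC (S : X → X) (U : Finset (Set X)) : Finset (Set X) :=
  U.image fun A => S ⁻¹' A

noncomputable def joinN (S : X → X) (U : Finset (Set X)) : ℕ → Finset (Set X)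
  | 0 => {Set.univ}
  | n + 1 => cJoin (joinN S U n) (preC (S^[n]) U)

def IsMCover (U : Finset (Set X)) : Prop :=
  (∀ A ∈ U, MeasurableSet A) ∧ ⋃₀ (U : Set (Set X)) = Set.univ

def IsMPartition (U : Finset (Set X)) : Prop :=
  IsMCover U ∧ ∀ A ∈ U, ∀ B ∈ U, A ≠ B → Disjoint A B

def Refines (α U : Finset (Set X)) : Prop := ∀ A ∈ α, ∃ B ∈ U, A ⊆ B

noncomputable def entPart (μ : Measure X) (α : Finset (Set X)) : ℝ :=
  ∑ A ∈ α, Real.negMulLog (μ A).toReal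

noncomputable def entCover (μ : Measure X) (U : Finset (Set X)) : ℝ :=
  sInf {h | ∃ α : Finset (Set X), IsMPartition α ∧ Refines α U ∧ h = entPart μ α}

noncomputable def hPart (μ : Measure X) (S : X → X) (α : Finset (Set X)) : ℝ :=
  limUnder atTop fun n : ℕ => entPart μ (joinN S α n) / n

noncomputable def hPlusC (μ : Measure X) (S : X → X) (U : Finset (Set X)) : ℝ :=
  sInf {h | ∃ α : Finset (Set X), IsMPartition α ∧ Refines α U ∧ h = hPart μ S α}

noncomputable def hMinusC (μ : Measure X) (S : X → X) (U : Finset (Set X)) : ℝ :=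
  limUnder atTop fun n : ℕ => entCover μ (joinN S U n) / n

noncomputable def covN (μ : Measure X) (V : Finset (Set X)) (ε : ℝ) : ℕ :=
  sInf {m | ∃ W ⊆ V, W.card = m ∧ 1 - ε < (μ (⋃₀ (W : Set (Set X)))).toReal}

noncomputable def covNfull (V : Finset (Set X)) : ℕ :=
  sInf {m | ∃ W ⊆ V, W.card = m ∧ ⋃₀ (W : Set (Set X)) = Set.univ}

/-- Measurability of a map into a type carrying the discrete σ-algebra. -/
def DiscMeasurable {ι : Type*} (f : X → ι) : Prop := ∀ s : Set ι, MeasurableSet (f ⁻¹' s)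

namespace DiscMeasurable

variable {ι κ : Type*} {f : X → ι}

theorem of_singleton [Countable ι] (h : ∀ i, MeasurableSet (f ⁻¹' {i})) : DiscMeasurable f := by
  intro s
  have : f ⁻¹' s = ⋃ i ∈ s, f ⁻¹' {i} := by ext x; simp
  rw [this]
  exact MeasurableSet.biUnion s.to_countable fun i _ => h i

theorem comp (hf : DiscMeasurable f) (g : ι → κ) : DiscMeasurable fun x => g (f x) :=
  fun s => hf (g ⁻¹' s)

theorem measurable_comp [MeasurableSpace κ] (hf : DiscMeasurable f) (g : ι → κ) :
    Measurable fun x => g (f x) :=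
  fun s _ => hf (g ⁻¹' s)

theorem comp_measurable (hf : DiscMeasurable f) {S : X → X} (hS : Measurable S) :
    DiscMeasurable fun x => f (S x) :=
  fun s => hS (hf s)

theorem prodMk [Countable ι] [Countable κ] {g : X → κ} (hf : DiscMeasurable f)
    (hg : DiscMeasurable g) : DiscMeasurable fun x => (f x, g x) := by
  refine of_singleton fun i => ?_
  have : (fun x => (f x, g x)) ⁻¹' {i} = f ⁻¹' {i.1} ∩ g ⁻¹' {i.2} := by
    ext x; simp [Prod.ext_iff]
  rw [this]
  exact (hf _).inter (hg _)

theorem integrable_comp [Finite ι] {μ : Measure X} [IsFiniteMeasure μ] (hf : DiscMeasurable f)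
    (g : ι → ℝ) : Integrable (fun x => g (f x)) μ := by
  have := Fintype.ofFinite ι
  refine Integrable.of_bound (hf.measurable_comp g).aestronglyMeasurable (∑ i, ‖g i‖)
    (Eventually.of_forall fun x => ?_)
  exact Finset.single_le_sum (f := fun i => ‖g i‖) (fun _ _ => norm_nonneg _) (Finset.mem_univ _)

theorem integral_comp [Fintype ι] {μ : Measure X} [IsFiniteMeasure μ] (hf : DiscMeasurable f)
    (g : ι → ℝ) : ∫ x, g (f x) ∂μ = ∑ i, μ.real (f ⁻¹' {i}) * g i := by
  have h : ∀ x, g (f x) = ∑ i, (f ⁻¹' {i}).indicator (fun _ => g i) x := by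
    intro x
    rw [Finset.sum_eq_single (f x)]
    · simp
    · intro i _ hi
      simp [Ne.symm hi]
    · simp
  simp_rw [h]
  rw [integral_finsetSum _ fun i _ => (integrable_const (g i)).indicator (hf {i})]
  refine Finset.sum_congr rfl fun i _ => ?_
  rw [integral_indicator_const _ (hf {i}), smul_eq_mul]

theorem sum_measureReal_fiber [Fintype ι] {μ : Measure X} [IsProbabilityMeasure μ]
    (hf : DiscMeasurable f) : ∑ i, μ.real (f ⁻¹' {i}) = 1 := by
  simpa using (hf.integral_comp (μ := μ) fun _ => (1 : ℝ)).symm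

end DiscMeasurable

/-- Shannon entropy of the distribution of a map into a finite type. -/
noncomputable def funEntropy {ι : Type*} [Fintype ι] (μ : Measure X) (f : X → ι) : ℝ :=
  ∑ i, Real.negMulLog (μ.real (f ⁻¹' {i}))

section Entropy

theorem negMulLog_le_mul_neg_log_add {p q : ℝ} (hp : 0 ≤ p) (hq : 0 ≤ q) (hpq : p ≠ 0 → 0 < q) :
    Real.negMulLog p ≤ p * -Real.log q + (q - p) := by
  rcases eq_or_ne p 0 with rfl | h
  · simpa using hq
  · have hp' : 0 < p := lt_of_le_of_ne hp h.symm
    have hq' := hpq h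
    have h1 := Real.log_le_sub_one_of_pos (div_pos hq' hp')
    rw [Real.log_div hq'.ne' h] at h1
    have h2 := mul_le_mul_of_nonneg_left h1 hp
    have h3 : p * (q / p - 1) = q - p := by field_simp
    rw [Real.negMulLog]
    nlinarith

variable {ι κ : Type*} [Fintype ι] [Fintype κ] {μ : Measure X}

theorem funEntropy_comp_injective (f : X → ι) {e : ι → κ} (he : Function.Injective e) :
    funEntropy μ (fun x => e (f x)) = funEntropy μ f := by
  unfold funEntropy
  rw [← Finset.sum_subset (Finset.subset_univ (Finset.univ.image e)),
    Finset.sum_image he.injOn]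
  · refine Finset.sum_congr rfl fun i _ => ?_
    congr 2
    ext x
    simp [he.eq_iff]
  · intro k _ hk
    have : (fun x => e (f x)) ⁻¹' {k} = ∅ := by
      ext x
      simp only [Set.mem_preimage, Set.mem_singleton_iff, Set.mem_empty_iff_false, iff_false]
      rintro rfl
      exact hk (by simp)
    simp [this]

variable [IsProbabilityMeasure μ] {f : X → ι}

theorem funEntropy_nonneg (f : X → ι) : 0 ≤ funEntropy μ f :=
  Finset.sum_nonneg fun _ _ => Real.negMulLog_nonneg measureReal_nonneg measureReal_le_one

/-- Gibbs' inequality. -/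
theorem funEntropy_le_integral_neg_log (hf : DiscMeasurable f) (q : ι → ℝ) (hq0 : ∀ i, 0 ≤ q i)
    (hq1 : ∑ i, q i ≤ 1) (hpos : ∀ i, μ.real (f ⁻¹' {i}) ≠ 0 → 0 < q i) :
    funEntropy μ f ≤ ∫ x, -Real.log (q (f x)) ∂μ := by
  rw [hf.integral_comp fun i => -Real.log (q i)]
  calc funEntropy μ f
      ≤ ∑ i, (μ.real (f ⁻¹' {i}) * -Real.log (q i) + (q i - μ.real (f ⁻¹' {i}))) :=
        Finset.sum_le_sum fun i _ =>
          negMulLog_le_mul_neg_log_add measureReal_nonneg (hq0 i) (hpos i)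
    _ ≤ _ := by
        rw [Finset.sum_add_distrib, Finset.sum_sub_distrib, hf.sum_measureReal_fiber]
        linarith

theorem ae_measureReal_fiber_ne_zero (f : X → ι) : ∀ᵐ x ∂μ, μ.real (f ⁻¹' {f x}) ≠ 0 := by
  have h : {x | ¬μ.real (f ⁻¹' {f x}) ≠ 0} = ⋃ i ∈ {i | μ.real (f ⁻¹' {i}) = 0}, f ⁻¹' {i} := by
    ext x
    simp
  rw [ae_iff, h, measure_biUnion_null_iff (Set.to_countable _)]
  exact fun i hi => (measureReal_eq_zero_iff).1 hi

theorem integral_neg_log_measureReal_fiber (hf : DiscMeasurable f) :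
    ∫ x, -Real.log (μ.real (f ⁻¹' {f x})) ∂μ = funEntropy μ f := by
  rw [hf.integral_comp fun i => -Real.log (μ.real (f ⁻¹' {i}))]
  exact Finset.sum_congr rfl fun i _ => by rw [Real.negMulLog]; ring

/-- If all sets of positive measure have measure at least `m`, entropies are at most `-log m`. -/
theorem funEntropy_le_of_forall_le_measureReal (hf : DiscMeasurable f) {m : ℝ} (hm : 0 < m)
    (h : ∀ s, MeasurableSet s → μ.real s ≠ 0 → m ≤ μ.real s) :
    funEntropy μ f ≤ -Real.log m := by
  have key := funEntropy_le_integral_neg_log (μ := μ) hf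
    (fun i => if μ.real (f ⁻¹' {i}) = 0 then 0 else m)
    (fun i => by split_ifs <;> positivity) ?_ (fun i hi => by simp [hi, hm])
  · refine key.trans ?_
    rw [hf.integral_comp fun i => -Real.log (if μ.real (f ⁻¹' {i}) = 0 then 0 else m)]
    calc _ = ∑ i, μ.real (f ⁻¹' {i}) * -Real.log m := by
          refine Finset.sum_congr rfl fun i _ => ?_
          split_ifs with h0 <;> simp [h0]
      _ ≤ _ := by rw [← Finset.sum_mul, hf.sum_measureReal_fiber, one_mul]
  · rw [← hf.sum_measureReal_fiber (μ := μ)]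
    refine Finset.sum_le_sum fun i _ => ?_
    split_ifs with h0
    · exact h0.ge
    · exact h _ (hf _) h0

end Entropy

/-- The partition of `X` into the fibres of a map. -/
noncomputable def fiberPartition {ι : Type*} [Fintype ι] (f : X → ι) : Finset (Set X) :=
  Finset.univ.image fun i => f ⁻¹' {i}

/-- The first `n` symbols of the orbit of a point. -/
def itinerary {X ι : Type*} (S : X → X) (f : X → ι) (n : ℕ) (x : X) : Fin n → ι :=
  fun i => f (S^[i] x)

section Partition

variable {ι : Type*} [Fintype ι] {μ : Measure X} {f : X → ι} {S : X → X}

theorem joinN_image {X : Type*} (S : X → X) (A : ι → Set X) (n : ℕ) :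
    joinN S (Finset.univ.image A) n =
      Finset.univ.image fun v : Fin n → ι => {x | ∀ i, S^[i] x ∈ A (v i)} := by
  induction n with
  | zero =>
    ext s
    simp [joinN]
  | succ n ih =>
    ext s
    simp only [joinN, cJoin, preC, ih, Finset.mem_image, Finset.mem_product, Finset.mem_univ,
      true_and, Prod.exists]
    constructor
    · rintro ⟨_, _, ⟨⟨v, rfl⟩, _, ⟨a, rfl⟩, rfl⟩, rfl⟩
      refine ⟨Fin.snoc (α := fun _ => ι) v a, ?_⟩
      ext x
      simp [Fin.forall_fin_succ']
    · rintro ⟨v, rfl⟩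
      refine ⟨_, _, ⟨⟨fun i => v i.castSucc, rfl⟩, _, ⟨v (Fin.last n), rfl⟩, rfl⟩, ?_⟩
      ext x
      simp [Fin.forall_fin_succ']

theorem joinN_fiberPartition {X : Type*} (S : X → X) (f : X → ι) (n : ℕ) :
    joinN S (Finset.univ.image fun i => f ⁻¹' {i}) n =
      Finset.univ.image fun v => itinerary S f n ⁻¹' {v} := by
  rw [joinN_image]
  congr 1
  ext v x
  simp [itinerary, funext_iff]

theorem entPart_fiberPartition (μ : Measure X) (f : X → ι) :
    entPart μ (fiberPartition f) = funEntropy μ f := by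
  unfold entPart fiberPartition funEntropy
  rw [Finset.sum_image_of_pairwise_eq_zero]
  · rfl
  · intro i _ j _ hij h
    have : f ⁻¹' {i} = ∅ := by
      ext x
      simp only [Set.mem_preimage, Set.mem_singleton_iff, Set.mem_empty_iff_false, iff_false]
      intro hx
      have : x ∈ f ⁻¹' {j} := h ▸ hx
      exact hij (hx.symm.trans this)
    simp [this]

theorem entPart_joinN_fiberPartition (μ : Measure X) (S : X → X) (f : X → ι) (n : ℕ) :
    entPart μ (joinN S (fiberPartition f) n) = funEntropy μ (itinerary S f n) := by
  rw [fiberPartition, joinN_fiberPartition, ← entPart_fiberPartition, fiberPartition]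

theorem isMPartition_fiberPartition (hf : DiscMeasurable f) : IsMPartition (fiberPartition f) := by
  refine ⟨⟨?_, ?_⟩, ?_⟩
  · simp only [fiberPartition, Finset.mem_image, Finset.mem_univ, true_and]
    rintro _ ⟨i, rfl⟩
    exact hf _
  · ext x
    simp [fiberPartition]
  · simp only [fiberPartition, Finset.mem_image, Finset.mem_univ, true_and]
    rintro _ ⟨i, rfl⟩ _ ⟨j, rfl⟩ hij
    rw [Set.disjoint_left]
    rintro x rfl hx
    exact hij (by rw [show f x = j from hx])

theorem refines_fiberPartition_iff {X : Type*} {f : X → ι} {U : Finset (Set X)} :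
    Refines (fiberPartition f) U ↔ ∀ i, ∃ B ∈ U, f ⁻¹' {i} ⊆ B := by
  simp [Refines, fiberPartition]

theorem IsMPartition.exists_fiberPartition_eq {α : Finset (Set X)} (hα : IsMPartition α) :
    ∃ f : X → α, DiscMeasurable f ∧ fiberPartition f = α ∧ ∀ x, x ∈ (f x).1 := by
  have h : ∀ x, ∃ A : α, x ∈ A.1 := fun x => by
    have : x ∈ ⋃₀ (α : Set (Set X)) := hα.1.2 ▸ Set.mem_univ x
    obtain ⟨A, hA, hx⟩ := this
    exact ⟨⟨A, hA⟩, hx⟩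
  choose f hf using h
  have hfib : ∀ A : α, f ⁻¹' {A} = A.1 := by
    intro A
    ext x
    constructor
    · rintro rfl
      exact hf x
    · intro hx
      by_contra hne
      exact Set.disjoint_left.1 (hα.2 _ (f x).2 _ A.2 fun h => hne (Subtype.ext h)) (hf x) hx
  refine ⟨f, .of_singleton fun A => hfib A ▸ hα.1.1 _ A.2, ?_, hf⟩
  ext s
  simp [fiberPartition, hfib]

theorem DiscMeasurable.itinerary (hf : DiscMeasurable f) (hS : Measurable S) (n : ℕ) :
    DiscMeasurable (itinerary S f n) := by
  refine .of_singleton fun v => ?_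
  have : _root_.itinerary S f n ⁻¹' {v} = ⋂ i : Fin n, S^[i] ⁻¹' (f ⁻¹' {v i}) := by
    ext x
    simp [_root_.itinerary, funext_iff]
  rw [this]
  exact MeasurableSet.iInter fun i => (hS.iterate i) (hf _)

theorem DiscMeasurable.integral_comp_iterate [IsFiniteMeasure μ] {κ : Type*} {g : X → κ}
    (hg : DiscMeasurable g) (hS : MeasurePreserving S μ μ) (F : κ → ℝ) (n : ℕ) :
    ∫ x, F (g (S^[n] x)) ∂μ = ∫ x, F (g x) ∂μ := by
  have h := (hS.iterate n)
  conv_rhs => rw [← h.map_eq]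
  rw [integral_map h.measurable.aemeasurable (hg.measurable_comp F).aestronglyMeasurable]

variable [IsProbabilityMeasure μ]

theorem subadditive_funEntropy_itinerary (hf : DiscMeasurable f) (hS : MeasurePreserving S μ μ) :
    Subadditive fun n => funEntropy μ (itinerary S f n) := by
  intro m n
  have hm := hf.itinerary hS.measurable m
  have hn := hf.itinerary hS.measurable n
  have hmn := hf.itinerary hS.measurable (m + n)
  let p : (Fin m → ι) → ℝ := fun v => μ.real (itinerary S f m ⁻¹' {v})
  let r : (Fin n → ι) → ℝ := fun v => μ.real (itinerary S f n ⁻¹' {v})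
  let L : (Fin (m + n) → ι) → (Fin m → ι) := fun v i => v (Fin.castAdd n i)
  let R : (Fin (m + n) → ι) → (Fin n → ι) := fun v i => v (Fin.natAdd m i)
  have hL : ∀ x, L (itinerary S f (m + n) x) = itinerary S f m x := fun x => rfl
  have hR : ∀ x, R (itinerary S f (m + n) x) = itinerary S f n (S^[m] x) := fun x => by
    funext i
    simp only [R, itinerary, Fin.val_natAdd, ← Function.iterate_add_apply]
    rw [add_comm]
  have hsub : ∀ v, itinerary S f (m + n) ⁻¹' {v} ⊆ itinerary S f m ⁻¹' {L v} := by
    rintro v x rfl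
    exact (hL x).symm
  have hsub' : ∀ v, itinerary S f (m + n) ⁻¹' {v} ⊆ S^[m] ⁻¹' (itinerary S f n ⁻¹' {R v}) := by
    rintro v x rfl
    exact (hR x).symm
  have hr : ∀ v, μ.real (S^[m] ⁻¹' (itinerary S f n ⁻¹' {v})) = r v := fun v => by
    rw [measureReal_def, (hS.iterate m).measure_preimage (hn _).nullMeasurableSet]
    rfl
  have hpos : ∀ v, μ.real (itinerary S f (m + n) ⁻¹' {v}) ≠ 0 → 0 < p (L v) ∧ 0 < r (R v) := by
    intro v hv
    have hv' : 0 < μ.real (itinerary S f (m + n) ⁻¹' {v}) :=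
      lt_of_le_of_ne measureReal_nonneg hv.symm
    exact ⟨hv'.trans_le (measureReal_mono (hsub v)),
      (hr (R v)) ▸ hv'.trans_le (measureReal_mono (hsub' v))⟩
  have key := funEntropy_le_integral_neg_log (μ := μ) hmn (fun v => p (L v) * r (R v))
    (fun v => mul_nonneg measureReal_nonneg measureReal_nonneg) ?_
    (fun v hv => mul_pos (hpos v hv).1 (hpos v hv).2)
  · refine key.trans ?_
    have h1 : ∫ x, -Real.log (p (itinerary S f m x)) ∂μ = funEntropy μ (itinerary S f m) :=
      integral_neg_log_measureReal_fiber hm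
    have h2 : ∫ x, -Real.log (r (itinerary S f n (S^[m] x))) ∂μ
        = funEntropy μ (itinerary S f n) := by
      rw [hn.integral_comp_iterate hS (fun v => -Real.log (r v)) m]
      exact integral_neg_log_measureReal_fiber hn
    beta_reduce
    rw [← h1, ← h2, ← integral_add (hm.integrable_comp fun v => -Real.log (p v))
      ((hn.comp_measurable (hS.iterate m).measurable).integrable_comp fun v => -Real.log (r v))]
    refine (integral_congr_ae ?_).le
    filter_upwards [ae_measureReal_fiber_ne_zero (itinerary S f (m + n))] with x hx
    have := hpos _ hx
    rw [hL, hR] at this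
    rw [hL, hR, Real.log_mul this.1.ne' this.2.ne']
    ring
  · have : ∑ v, p (L v) * r (R v) = ∑ w : (Fin m → ι) × (Fin n → ι), p w.1 * r w.2 := by
      refine Fintype.sum_equiv (Fin.appendEquiv m n).symm _ _ fun v => ?_
      rfl
    rw [this, Fintype.sum_prod_type]
    simp_rw [← Finset.mul_sum]
    rw [show ∑ v, r v = 1 from hn.sum_measureReal_fiber]
    simp only [mul_one]
    exact (hm.sum_measureReal_fiber).le

theorem tendsto_funEntropy_itinerary_div (hf : DiscMeasurable f) (hS : MeasurePreserving S μ μ) :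
    Tendsto (fun n : ℕ => funEntropy μ (itinerary S f n) / n) atTop
      (𝓝 (hPart μ S (fiberPartition f))) := by
  have hbdd : BddBelow (Set.range fun n : ℕ => funEntropy μ (itinerary S f n) / n) :=
    ⟨0, by
      rintro _ ⟨n, rfl⟩
      exact div_nonneg (funEntropy_nonneg _) n.cast_nonneg⟩
  have h := (subadditive_funEntropy_itinerary hf hS).tendsto_lim hbdd
  unfold hPart
  simp_rw [entPart_joinN_fiberPartition]
  rwa [h.limUnder_eq]

theorem hPlusC_le_hPart (hS : MeasurePreserving S μ μ) {U : Finset (Set X)}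
    (hf : DiscMeasurable f) (hfU : ∀ i, ∃ B ∈ U, f ⁻¹' {i} ⊆ B) :
    hPlusC μ S U ≤ hPart μ S (fiberPartition f) := by
  refine csInf_le ⟨0, ?_⟩ ⟨_, isMPartition_fiberPartition hf, ?_, rfl⟩
  · rintro _ ⟨α, hα, -, rfl⟩
    obtain ⟨g, hg, hgα, -⟩ := hα.exists_fiberPartition_eq
    rw [← hgα]
    exact ge_of_tendsto' (tendsto_funEntropy_itinerary_div hg hS) fun n =>
      div_nonneg (funEntropy_nonneg _) n.cast_nonneg
  · exact refines_fiberPartition_iff.2 hfU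

end Partition

section Markov

variable {Z : Type*} [Fintype Z]

theorem sum_prod_transition_le (P : Z → Z → ℝ) (hP0 : ∀ a b, 0 ≤ P a b)
    (hP1 : ∀ a, ∑ b, P a b ≤ 1) (n : ℕ) :
    ∑ v : Fin (n + 1) → Z, ∏ i : Fin n, P (v i.castSucc) (v i.succ) ≤ Fintype.card Z := by
  induction n with
  | zero => simp
  | succ n ih =>
    refine le_trans (le_of_eq ?_) (le_trans (Finset.sum_le_sum
      (f := fun v : Fin (n + 1) → Z =>
        (∏ i : Fin n, P (v i.castSucc) (v i.succ)) * ∑ b, P (v (Fin.last n)) b)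
      fun v _ => ?_) ih)
    · rw [← (Fin.snocEquiv fun _ => Z).sum_comp, Fintype.sum_prod_type, Finset.sum_comm]
      refine Finset.sum_congr rfl fun v _ => ?_
      rw [Finset.mul_sum]
      refine Finset.sum_congr rfl fun b _ => ?_
      rw [Fin.prod_univ_castSucc]
      simp [Fin.snocEquiv, ← Fin.castSucc_succ]
    · exact mul_le_of_le_one_right (Finset.prod_nonneg fun _ _ => hP0 _ _) (hP1 _)

variable {μ : Measure X} [IsProbabilityMeasure μ] {S : X → X} {z : X → Z}

/-- The entropy rate of a stationary process is at most the mean transition cost of any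
sub-Markovian kernel. -/
theorem hPart_fiberPartition_le_integral (hS : MeasurePreserving S μ μ) (hz : DiscMeasurable z)
    (P : Z → Z → ℝ) (hP0 : ∀ a b, 0 ≤ P a b) (hP1 : ∀ a, ∑ b, P a b ≤ 1)
    (hpos : ∀ x, 0 < P (z x) (z (S x))) :
    hPart μ S (fiberPartition z) ≤ ∫ x, -Real.log (P (z x) (z (S x))) ∂μ := by
  set c := ∫ x, -Real.log (P (z x) (z (S x))) ∂μ with hc
  have hpair : DiscMeasurable fun x => (z x, z (S x)) := hz.prodMk (hz.comp_measurable hS.measurable)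
  have : Nonempty X := nonempty_of_neBot (ae μ)
  have : Nonempty Z := this.map z
  have hcard : (0 : ℝ) < Fintype.card Z := by exact_mod_cast Fintype.card_pos
  have hbound : ∀ n : ℕ,
      funEntropy μ (itinerary S z (n + 1)) ≤ Real.log (Fintype.card Z) + n * c := by
    intro n
    have hq := sum_prod_transition_le P hP0 hP1 n
    have hprod : ∀ x, ∏ i : Fin n, P (itinerary S z (n + 1) x i.castSucc)
        (itinerary S z (n + 1) x i.succ) = ∏ i : Fin n, P (z (S^[i] x)) (z (S (S^[i] x))) := by
      intro x
      simp [itinerary, Function.iterate_succ_apply']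
    have key := funEntropy_le_integral_neg_log (μ := μ) (hz.itinerary hS.measurable (n + 1))
      (fun v => (∏ i : Fin n, P (v i.castSucc) (v i.succ)) / Fintype.card Z)
      (fun v => div_nonneg (Finset.prod_nonneg fun _ _ => hP0 _ _) hcard.le)
      (by rw [← Finset.sum_div]; exact (div_le_one hcard).2 hq) ?_
    · refine key.trans_eq ?_
      calc _ = ∫ x, (Real.log (Fintype.card Z)
              + ∑ i : Fin n, -Real.log (P (z (S^[i] x)) (z (S (S^[i] x))))) ∂μ := by
            refine integral_congr_ae (Eventually.of_forall fun x => ?_)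
            beta_reduce
            rw [hprod, Real.log_div (Finset.prod_pos fun _ _ => hpos _).ne' hcard.ne',
              Real.log_prod fun i _ => (hpos _).ne', Finset.sum_neg_distrib]
            ring
        _ = Real.log (Fintype.card Z) + n * c := by
            have hint : ∀ i : Fin n, Integrable
                (fun x => -Real.log (P (z (S^[i] x)) (z (S (S^[i] x))))) μ := fun i =>
              (hpair.comp_measurable (hS.iterate i).measurable).integrable_comp
                fun p => -Real.log (P p.1 p.2)
            rw [integral_add (integrable_const _) (integrable_finsetSum _ fun i _ => hint i),
              integral_finsetSum _ fun i _ => hint i]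
            have : ∀ i : Fin n, ∫ x, -Real.log (P (z (S^[i] x)) (z (S (S^[i] x)))) ∂μ = c :=
              fun i => hpair.integral_comp_iterate hS (fun p => -Real.log (P p.1 p.2)) i
            simp [this]
    · intro v hv
      have : (itinerary S z (n + 1) ⁻¹' {v}).Nonempty := by
        rw [Set.nonempty_iff_ne_empty]
        intro h
        simp [h] at hv
      obtain ⟨x, rfl⟩ := this
      rw [hprod]
      exact div_pos (Finset.prod_pos fun _ _ => hpos _) hcard
  have hlim := (tendsto_add_atTop_iff_nat 1).2 (tendsto_funEntropy_itinerary_div (μ := μ) hz hS)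
  have hlim2 : Tendsto
      (fun n : ℕ => (Real.log (Fintype.card Z) - c) * (1 / ((n : ℝ) + 1)) + c) atTop (𝓝 c) := by
    simpa using (tendsto_one_div_add_atTop_nhds_zero_nat (𝕜 := ℝ)).const_mul
      (Real.log (Fintype.card Z) - c) |>.add_const c
  refine le_of_tendsto_of_tendsto' hlim hlim2 fun n => ?_
  have h1 : (0 : ℝ) < n + 1 := by positivity
  push_cast
  rw [div_le_iff₀ h1]
  have := hbound n
  field_simp
  linarith

end Markov

section MeanErgodic

variable {μ : Measure X} [IsProbabilityMeasure μ] {S : X → X}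

/-- The mean ergodic theorem, as convergence in measure. -/
theorem tendsto_measure_birkhoff_average (hS : Ergodic S μ) {g : X → ℝ} (hg : MemLp g 2 μ)
    {η : ℝ} (hη : 0 < η) :
    Tendsto (fun n : ℕ => μ.real {x | ∫ x, g x ∂μ + η ≤ (∑ i ∈ Finset.range n, g (S^[i] x)) / n})
      atTop (𝓝 0) := by
  have hmp := hS.toMeasurePreserving
  let K : Lp ℝ 2 μ →L[ℝ] Lp ℝ 2 μ := (Lp.compMeasurePreservingₗᵢ ℝ S hmp).toContinuousLinearMap
  have hK : ‖K‖ ≤ 1 := LinearIsometry.norm_toContinuousLinearMap_le _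
  let G : Lp ℝ 2 μ := hg.toLp g
  have hlim := K.tendsto_birkhoffAverage_orthogonalProjection hK G
  set p : Lp ℝ 2 μ := ((K.eqLocus (1 : Lp ℝ 2 μ →L[ℝ] Lp ℝ 2 μ)).orthogonalProjectionOnto G : Lp ℝ 2 μ)
    with hp
  have hpfix : K p = p :=
    ((K.eqLocus (1 : Lp ℝ 2 μ →L[ℝ] Lp ℝ 2 μ)).orthogonalProjectionOnto G).2
  have hKae : ∀ f : Lp ℝ 2 μ, (K f : X → ℝ) =ᵐ[μ] f ∘ S := fun f =>
    Lp.coeFn_compMeasurePreserving f hmp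
  obtain ⟨c, hc⟩ := hS.ae_eq_const_of_ae_eq_comp_ae (Lp.aestronglyMeasurable p)
    ((hKae p).symm.trans (by rw [hpfix]))
  have hiter : ∀ n : ℕ, ((K^[n] G : Lp ℝ 2 μ) : X → ℝ) =ᵐ[μ] fun x => g (S^[n] x) := by
    intro n
    induction n with
    | zero => exact hg.coeFn_toLp
    | succ n ih =>
      rw [Function.iterate_succ_apply']
      refine (hKae _).trans ?_
      exact (hmp.quasiMeasurePreserving.ae_eq_comp ih).trans
        (Eventually.of_forall fun x => by simp [Function.iterate_succ_apply])
  have havg : ∀ n : ℕ, ((birkhoffAverage ℝ K id n G : Lp ℝ 2 μ) : X → ℝ) =ᵐ[μ]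
      fun x => (∑ i ∈ Finset.range n, g (S^[i] x)) / n := by
    intro n
    have hsum : ∀ s : Finset ℕ, ((∑ i ∈ s, K^[i] G : Lp ℝ 2 μ) : X → ℝ) =ᵐ[μ]
        fun x => ∑ i ∈ s, g (S^[i] x) := by
      intro s
      induction s using Finset.induction_on with
      | empty => exact Lp.coeFn_zero ℝ 2 μ
      | insert a s ha ih =>
        rw [Finset.sum_insert ha]
        filter_upwards [Lp.coeFn_add (K^[a] G) (∑ i ∈ s, K^[i] G), ih, hiter a] with x h1 h2 h3
        rw [h1, Pi.add_apply, h2, h3, Finset.sum_insert ha]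
    unfold birkhoffAverage birkhoffSum
    filter_upwards [Lp.coeFn_smul (n : ℝ)⁻¹ (∑ i ∈ Finset.range n, K^[i] G),
      hsum (Finset.range n)] with x h1 h2
    simp only [id]
    rw [h1, Pi.smul_apply, h2, smul_eq_mul, div_eq_inv_mul]
  have hintG : ∀ f : Lp ℝ 2 μ, Integrable f μ := fun f =>
    (Lp.memLp f).integrable (by norm_num)
  have hcint : c = ∫ x, g x ∂μ := by
    let one : Lp ℝ 2 μ := (memLp_const (1 : ℝ)).toLp _
    have hinner : ∀ f : Lp ℝ 2 μ, inner ℝ one f = ∫ x, f x ∂μ := by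
      intro f
      rw [L2.inner_def]
      exact integral_congr_ae (Eventually.of_forall fun x => by simp [one])
    have h1 : Tendsto (fun n => inner ℝ one (birkhoffAverage ℝ K id n G)) atTop
        (𝓝 (inner ℝ one p)) := (tendsto_const_nhds).inner hlim
    have h2 : inner ℝ one p = c := by
      rw [hinner, integral_congr_ae hc]
      simp
    have hmem : ∀ i : ℕ, Integrable (fun x => g (S^[i] x)) μ := fun i =>
      (integrable_congr (hiter i)).1 (hintG _)
    have h3 : ∀ n : ℕ, n ≠ 0 → inner ℝ one (birkhoffAverage ℝ K id n G) = ∫ x, g x ∂μ := by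
      intro n hn
      rw [hinner, integral_congr_ae (havg n), integral_div,
        integral_finsetSum _ fun i _ => hmem i]
      have : ∀ i : ℕ, ∫ x, g (S^[i] x) ∂μ = ∫ x, g x ∂μ := fun i => by
        have h := hmp.iterate i
        conv_rhs => rw [← h.map_eq]
        rw [integral_map h.measurable.aemeasurable (by rw [h.map_eq]; exact hg.1)]
      simp only [this, Finset.sum_const, Finset.card_range, nsmul_eq_mul]
      field_simp
    rw [h2] at h1
    refine tendsto_nhds_unique h1 (tendsto_const_nhds.congr' ?_)
    filter_upwards [eventually_ne_atTop 0] with n hn using (h3 n hn).symm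
  have hmeas := tendstoInMeasure_of_tendsto_Lp hlim
  rw [tendstoInMeasure_iff_norm] at hmeas
  have h0 := (ENNReal.tendsto_toReal ENNReal.zero_ne_top).comp (hmeas η hη)
  rw [ENNReal.toReal_zero] at h0
  refine squeeze_zero (fun n => measureReal_nonneg) (fun n => ?_) h0
  refine ENNReal.toReal_mono (measure_ne_top _ _) (measure_mono_ae ?_)
  filter_upwards [havg n, hc] with x h1 h2 hx
  change η ≤ ‖_‖
  rw [h1, h2, Function.const_apply, hcint, Real.norm_eq_abs]
  have hx' : ∫ x, g x ∂μ + η ≤ (∑ i ∈ Finset.range n, g (S^[i] x)) / n := hx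
  exact le_trans (by linarith) (le_abs_self _)

end MeanErgodic

section Upper

theorem mem_joinN_iff {X : Type*} {S : X → X} {U : Finset (Set X)} {n : ℕ} {s : Set X} :
    s ∈ joinN S U n ↔ ∃ v : Fin n → U, s = {x | ∀ i, S^[i] x ∈ (v i).1} := by
  have h : U = Finset.univ.image fun A : U => A.1 := by ext; simp
  conv_lhs => rw [h, joinN_image]
  simp [eq_comm]

theorem covN_le_card {μ : Measure X} {V W : Finset (Set X)} {ε : ℝ} (hW : W ⊆ V)
    (h : 1 - ε < (μ (⋃₀ (W : Set (Set X)))).toReal) : covN μ V ε ≤ W.card :=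
  Nat.sInf_le ⟨W, hW, rfl, h⟩

variable {ι : Type*} [Fintype ι] {μ : Measure X} [IsProbabilityMeasure μ] {S : X → X} {f : X → ι}

/-- Some conditional entropy of the next symbol given the past comes close to the entropy rate. -/
theorem exists_funEntropy_sub_lt (hS : MeasurePreserving S μ μ) (hf : DiscMeasurable f) {b : ℝ}
    (hb : hPart μ S (fiberPartition f) < b) :
    ∃ k, funEntropy μ (itinerary S f (k + 1 + 1)) - funEntropy μ (itinerary S f (k + 1)) < b := by
  by_contra! h
  set u : ℕ → ℝ := fun n => funEntropy μ (itinerary S f n)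
  have hgrow : ∀ n : ℕ, n * b ≤ u (n + 1) := by
    intro n
    induction n with
    | zero => simpa using funEntropy_nonneg _
    | succ n ih =>
      have := h n
      push_cast
      linarith
  have h1 := (tendsto_add_atTop_iff_nat 1).2 (tendsto_funEntropy_itinerary_div (μ := μ) hf hS)
  have h2 : Tendsto (fun n : ℕ => b - b * (1 / ((n : ℝ) + 1))) atTop (𝓝 b) := by
    simpa using ((tendsto_one_div_add_atTop_nhds_zero_nat (𝕜 := ℝ)).const_mul b).const_sub b
  refine hb.not_ge (le_of_tendsto_of_tendsto' h2 h1 fun n => ?_)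
  have h3 : (0 : ℝ) < n + 1 := by positivity
  push_cast
  rw [le_div_iff₀ h3]
  have := hgrow n
  field_simp
  simp only [u] at this
  linarith

theorem itinerary_pair_eq {X ι : Type*} (S : X → X) (f : X → ι) (k : ℕ) (x : X) :
    (itinerary S f k x, itinerary S f k (S x)) =
      ((fun i => itinerary S f (k + 1) x i.castSucc), fun i => itinerary S f (k + 1) x i.succ) :=
  rfl

theorem funEntropy_itinerary_pair (μ : Measure X) (S : X → X) (f : X → ι) (k : ℕ) :
    funEntropy μ (fun x => (itinerary S f (k + 1) x, itinerary S f (k + 1) (S x))) =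
      funEntropy μ (itinerary S f (k + 1 + 1)) := by
  simp_rw [itinerary_pair_eq]
  refine funEntropy_comp_injective (itinerary S f (k + 1 + 1))
    (e := fun v => ((fun i : Fin (k + 1) => v i.castSucc), fun i : Fin (k + 1) => v i.succ)) ?_
  intro v w h
  simp only [Prod.mk.injEq, funext_iff] at h
  funext i
  refine Fin.cases ?_ (fun j => h.2 j) i
  exact h.1 0

/-- Transition probabilities of a finite-valued process. -/
noncomputable def transitionProb {Z : Type*} (μ : Measure X) (S : X → X) (z : X → Z) (a b : Z) :
    ℝ :=
  μ.real ((fun x => (z x, z (S x))) ⁻¹' {(a, b)}) / μ.real (z ⁻¹' {a})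

theorem transitionProb_nonneg {Z : Type*} (μ : Measure X) (S : X → X) (z : X → Z) (a b : Z) :
    0 ≤ transitionProb μ S z a b :=
  div_nonneg measureReal_nonneg measureReal_nonneg

section Transition

variable {Z : Type*} [Fintype Z] {z : X → Z}

theorem sum_transitionProb_le_one (hS : Measurable S) (hz : DiscMeasurable z) (a : Z) :
    ∑ b, transitionProb μ S z a b ≤ 1 := by
  unfold transitionProb
  rw [← Finset.sum_div]
  refine div_le_one_of_le₀ ?_ measureReal_nonneg
  have hpair := hz.prodMk (hz.comp_measurable hS)
  rw [← Finset.sum_image (s := Finset.univ) (g := fun b => (a, b))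
    (f := fun p => μ.real ((fun x => (z x, z (S x))) ⁻¹' {p})) (by intro; simp),
    sum_measureReal_preimage_singleton _ fun p _ => hpair _]
  refine measureReal_mono fun x hx => ?_
  simp only [Finset.coe_image, Set.mem_preimage, Set.mem_image] at hx
  obtain ⟨b, -, hb⟩ := hx
  exact (Prod.ext_iff.1 hb).1.symm

theorem ae_transitionProb_pos (S : X → X) (z : X → Z) :
    ∀ᵐ x ∂μ, 0 < μ.real ((fun x => (z x, z (S x))) ⁻¹' {(z x, z (S x))}) ∧
      0 < μ.real (z ⁻¹' {z x}) := by
  filter_upwards [ae_measureReal_fiber_ne_zero z,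
    ae_measureReal_fiber_ne_zero fun x => (z x, z (S x))] with x h1 h2
  exact ⟨lt_of_le_of_ne measureReal_nonneg h2.symm, lt_of_le_of_ne measureReal_nonneg h1.symm⟩

theorem integral_neg_log_transitionProb (hS : Measurable S) (hz : DiscMeasurable z) :
    ∫ x, -Real.log (transitionProb μ S z (z x) (z (S x))) ∂μ =
      funEntropy μ (fun x => (z x, z (S x))) - funEntropy μ z := by
  have hpair := hz.prodMk (hz.comp_measurable hS)
  rw [← integral_neg_log_measureReal_fiber hz, ← integral_neg_log_measureReal_fiber hpair,
    ← integral_sub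
      (hpair.integrable_comp fun p => -Real.log (μ.real ((fun x => (z x, z (S x))) ⁻¹' {p})))
      (hz.integrable_comp fun p => -Real.log (μ.real (z ⁻¹' {p})))]
  refine integral_congr_ae ?_
  filter_upwards [ae_transitionProb_pos (μ := μ) S z] with x hx
  rw [transitionProb, Real.log_div hx.1.ne' hx.2.ne']
  ring

end Transition

/-- Covering numbers grow at most at the entropy rate of any partition refining the cover. -/
theorem eventually_log_covN_div_le (hS : Ergodic S μ) (hf : DiscMeasurable f)
    {U : Finset (Set X)} (hfU : ∀ i, ∃ B ∈ U, f ⁻¹' {i} ⊆ B) {ε : ℝ} (hε : 0 < ε) {b : ℝ}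
    (hb : hPart μ S (fiberPartition f) < b) :
    ∀ᶠ n : ℕ in atTop, Real.log (covN μ (joinN S U n) ε) / n ≤ b := by
  choose u huU hu using hfU
  have hmp := hS.toMeasurePreserving
  obtain ⟨b₁, hb₁, hb₁b⟩ := exists_between hb
  have hb₁0 : 0 ≤ b₁ := le_trans (ge_of_tendsto' (tendsto_funEntropy_itinerary_div hf hmp)
    fun n => div_nonneg (funEntropy_nonneg _) n.cast_nonneg) hb₁.le
  obtain ⟨k, hk⟩ := exists_funEntropy_sub_lt hmp hf hb₁
  set z := itinerary S f (k + 1)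
  have hz : DiscMeasurable z := hf.itinerary hmp.measurable _
  have hpair := hz.prodMk (hz.comp_measurable hmp.measurable)
  set P := transitionProb μ S z with hP
  set g : X → ℝ := fun x => -Real.log (P (z x) (z (S x))) with hg
  have hgint : ∫ x, g x ∂μ < b₁ := by
    rw [integral_neg_log_transitionProb hmp.measurable hz, funEntropy_itinerary_pair]
    exact hk
  have hgL2 : MemLp g 2 μ := by
    have h := hpair.integrable_comp (μ := μ) fun p => ‖-Real.log (P p.1 p.2)‖ ^ 2
    refine (memLp_two_iff_integrable_sq_norm
      (hpair.measurable_comp fun p => -Real.log (P p.1 p.2)).aestronglyMeasurable).2 h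
  have : Nonempty X := nonempty_of_neBot (ae μ)
  have : Nonempty (Fin (k + 1) → ι) := this.map z
  set C : ℝ := ((Fintype.card (Fin (k + 1) → ι) : ℕ) : ℝ)
  have hC : (0 : ℝ) < C := Nat.cast_pos.2 Fintype.card_pos
  have hC1 : (1 : ℝ) ≤ C := Nat.one_le_cast.2 Fintype.card_pos
  have hmeas := tendsto_measure_birkhoff_average hS hgL2 (sub_pos.2 hgint)
  have hlog : Tendsto (fun n : ℕ => Real.log C / n) atTop (𝓝 0) :=
    tendsto_const_div_atTop_nhds_zero_nat _
  filter_upwards [hmeas.eventually_lt_const hε, hlog.eventually_lt_const (sub_pos.2 hb₁b),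
    eventually_gt_atTop 0] with n hn hnC hn0
  have hn0' : (0 : ℝ) < n := Nat.cast_pos.2 hn0
  set Q : (Fin (n + 1) → Fin (k + 1) → ι) → ℝ :=
    fun v => ∏ i : Fin n, P (v i.castSucc) (v i.succ) with hQ
  have hQ0 : ∀ v, 0 ≤ Q v := fun v => Finset.prod_nonneg fun _ _ => transitionProb_nonneg _ _ _ _ _
  have hQsum : ∑ v, Q v ≤ C := sum_prod_transition_le P (transitionProb_nonneg μ S z)
    (sum_transitionProb_le_one hmp.measurable hz) n
  set V := Finset.univ.filter fun v => Real.exp (-(n * b₁)) ≤ Q v with hV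
  have hVcard : (V.card : ℝ) ≤ C * Real.exp (n * b₁) := by
    have h1 : V.card * Real.exp (-(n * b₁)) ≤ C := by
      refine le_trans ?_ hQsum
      rw [← nsmul_eq_mul]
      refine (Finset.card_nsmul_le_sum V Q _ fun v hv => (Finset.mem_filter.1 hv).2).trans ?_
      exact Finset.sum_le_sum_of_subset_of_nonneg (Finset.subset_univ _) fun v _ _ => hQ0 v
    rw [Real.exp_neg] at h1
    have := Real.exp_pos (n * b₁)
    field_simp at h1
    linarith
  set cell : (Fin (n + 1) → Fin (k + 1) → ι) → Set X :=
    fun v => {x | ∀ i : Fin n, S^[i] x ∈ u (v i.castSucc 0)} with hcell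
  have hWsub : V.image cell ⊆ joinN S U n := by
    intro s hs
    obtain ⟨v, -, rfl⟩ := Finset.mem_image.1 hs
    exact mem_joinN_iff.2 ⟨fun i => ⟨_, huU (v i.castSucc 0)⟩, rfl⟩
  have hWmeas : 1 - ε < (μ (⋃₀ (V.image cell : Set (Set X)))).toReal := by
    set B := {x | ∫ x, g x ∂μ + (b₁ - ∫ x, g x ∂μ) ≤ (∑ i ∈ Finset.range n, g (S^[i] x)) / n}
    have hcov : ∀ᵐ x ∂μ, x ∈ ⋃₀ (V.image cell : Set (Set X)) ∪ B := by
      have hall : ∀ᵐ x ∂μ, ∀ i : ℕ, 0 < P (z (S^[i] x)) (z (S (S^[i] x))) := by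
        rw [ae_all_iff]
        intro i
        refine (hmp.iterate i).quasiMeasurePreserving.ae
          (p := fun x => 0 < P (z x) (z (S x))) ?_
        filter_upwards [ae_transitionProb_pos (μ := μ) S z] with x hx
        exact div_pos hx.1 hx.2
      filter_upwards [hall] with x hx
      by_cases hxB : x ∈ B
      · exact Or.inr hxB
      · refine Or.inl ⟨cell (itinerary S z (n + 1) x), ?_, fun i => hu _ rfl⟩
        refine Finset.mem_coe.2 (Finset.mem_image_of_mem _ (Finset.mem_filter.2
          ⟨Finset.mem_univ _, ?_⟩))
        have hQx : Q (itinerary S z (n + 1) x) =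
            Real.exp (-∑ i ∈ Finset.range n, g (S^[i] x)) := by
          rw [Finset.sum_range, ← Finset.sum_neg_distrib, Real.exp_sum]
          refine Finset.prod_congr rfl fun i _ => ?_
          rw [hg, neg_neg, Real.exp_log (hx i)]
          simp [itinerary, Function.iterate_succ_apply']
        rw [hQx]
        refine Real.exp_le_exp.2 (neg_le_neg ?_)
        have : (∑ i ∈ Finset.range n, g (S^[i] x)) / n < b₁ := by
          simpa [B] using hxB
        rw [div_lt_iff₀ hn0'] at this
        linarith
    have h1 : (1 : ℝ) ≤ μ.real (⋃₀ (V.image cell : Set (Set X))) + μ.real B := by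
      refine le_trans ?_ (measureReal_union_le _ _)
      rw [← probReal_univ (μ := μ)]
      exact ENNReal.toReal_mono (measure_ne_top _ _) (measure_mono_ae (hcov.mono fun x hx _ => hx))
    rw [measureReal_def] at h1
    linarith
  have hcov : (covN μ (joinN S U n) ε : ℝ) ≤ C * Real.exp (n * b₁) := by
    refine le_trans (Nat.cast_le.2 ?_) hVcard
    exact (covN_le_card hWsub hWmeas).trans Finset.card_image_le
  have hlogcov : Real.log (covN μ (joinN S U n) ε) ≤ Real.log C + n * b₁ := by
    rcases Nat.eq_zero_or_pos (covN μ (joinN S U n) ε) with h0 | h0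
    · rw [h0]
      simpa using add_nonneg (Real.log_nonneg hC1) (mul_nonneg hn0'.le hb₁0)
    · refine (Real.log_le_log (Nat.cast_pos.2 h0) hcov).trans_eq ?_
      rw [Real.log_mul hC.ne' (Real.exp_ne_zero _), Real.log_exp]
  calc Real.log (covN μ (joinN S U n) ε) / n ≤ (Real.log C + n * b₁) / n := by gcongr
    _ = Real.log C / n + b₁ := by field_simp
    _ ≤ b := by linarith

end Upper

section Selection

theorem exists_discMeasurable_selection {κ : Type*} [Countable κ] (E : κ → Set X)
    (hE : ∀ k, MeasurableSet (E k)) (hcov : ∀ x, ∃ k, x ∈ E k) :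
    ∃ w : X → κ, DiscMeasurable w ∧ ∀ x, x ∈ E (w x) := by
  obtain ⟨e, he⟩ := Countable.exists_injective_nat κ
  have h : ∀ x, ∃ k, x ∈ E k ∧ ∀ j, e j < e k → x ∉ E j := by
    intro x
    have hx : ∃ n, ∃ k, e k = n ∧ x ∈ E k := (hcov x).imp' e fun k hk => ⟨k, rfl, hk⟩
    obtain ⟨k, hk, hxk⟩ := Nat.find_spec hx
    refine ⟨k, hxk, fun j hj hxj => ?_⟩
    exact Nat.find_min hx (hk ▸ hj) ⟨j, rfl, hxj⟩
  choose w hw hmin using h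
  refine ⟨w, .of_singleton fun k => ?_, hw⟩
  have : w ⁻¹' {k} = E k \ ⋃ j ∈ {j | e j < e k}, E j := by
    ext x
    simp only [Set.mem_preimage, Set.mem_singleton_iff, Set.mem_sdiff, Set.mem_iUnion,
      Set.mem_ofPred_eq, not_exists]
    constructor
    · rintro rfl
      exact ⟨hw x, hmin x⟩
    · rintro ⟨hx, hx'⟩
      refine he (le_antisymm ?_ ?_)
      · exact not_lt.1 fun hlt => hmin x k hlt hx
      · exact not_lt.1 fun hlt => hx' _ hlt (hw x)
  rw [this]
  exact (hE k).diff (MeasurableSet.biUnion (Set.to_countable _) fun j _ => hE j)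

variable {μ : Measure X} [IsProbabilityMeasure μ]

theorem exists_measureReal_lt_of_antitone {B : ℕ → Set X} (hB : ∀ n, MeasurableSet (B n))
    (hanti : Antitone B) (hnull : ∀ᵐ x ∂μ, ∃ n, x ∉ B n) {η : ℝ} (hη : 0 < η) :
    ∃ n, μ.real (B n) < η := by
  have h := tendsto_measure_iInter_atTop (μ := μ) (fun n => (hB n).nullMeasurableSet) hanti
    ⟨0, measure_ne_top _ _⟩
  have h0 : μ (⋂ n, B n) = 0 := by
    rw [ae_iff] at hnull
    convert hnull using 2
    ext x
    simp
  rw [h0] at h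
  have h1 := (ENNReal.tendsto_toReal ENNReal.zero_ne_top).comp h
  exact (h1.eventually_lt_const (by simpa using hη)).exists

theorem Ergodic.ae_exists_iterate_mem {S : X → X} (hS : Ergodic S μ) {s : Set X}
    (hs : MeasurableSet s) (h0 : μ s ≠ 0) : ∀ᵐ x ∂μ, ∃ n, S^[n] x ∈ s := by
  have hmeas : MeasurableSet (⋃ n, S^[n] ⁻¹' s) :=
    MeasurableSet.iUnion fun n => (hS.measurable.iterate n) hs
  have hsub : S ⁻¹' (⋃ n, S^[n] ⁻¹' s) ≤ᵐ[μ] ⋃ n, S^[n] ⁻¹' s := by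
    refine LE.le.eventuallyLE fun x hx => ?_
    simp only [Set.mem_preimage, Set.mem_iUnion] at hx ⊢
    obtain ⟨n, hn⟩ := hx
    exact ⟨n + 1, hn⟩
  rcases hS.ae_empty_or_univ_of_preimage_ae_le hmeas.nullMeasurableSet hsub with h | h
  · exact absurd (measure_mono_null (Set.subset_iUnion (fun n => S^[n] ⁻¹' s) 0)
      (ae_eq_empty.1 h)) h0
  · filter_upwards [h] with x hx
    have hx' : x ∈ ⋃ n, S^[n] ⁻¹' s := cast hx.symm trivial
    simpa using hx'

/-- A small set visited by every backward orbit within a bounded time. -/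
theorem exists_marker {T : X ≃ᵐ X} (hT : Ergodic T μ)
    (hsmall : ∀ δ > 0, ∃ s, MeasurableSet s ∧ μ s ≠ 0 ∧ μ.real s < δ) {η : ℝ} (hη : 0 < η) :
    ∃ (F : Set X) (K : ℕ), MeasurableSet F ∧ μ.real F < η ∧ ∀ y, ∃ t ≤ K, T.symm^[t] y ∈ F := by
  obtain ⟨s, hs, hs0, hsη⟩ := hsmall (η / 2) (half_pos hη)
  set B : ℕ → Set X := fun n => {x | ∀ t ≤ n, T.symm^[t] x ∉ s} with hB
  have hBmeas : ∀ n, MeasurableSet (B n) := by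
    intro n
    have : B n = ⋂ t ∈ Set.Iic n, T.symm^[t] ⁻¹' sᶜ := by ext x; simp [B]
    rw [this]
    exact MeasurableSet.biInter (Set.to_countable _) fun t _ =>
      (T.symm.measurable.iterate t) hs.compl
  obtain ⟨K, hK⟩ := exists_measureReal_lt_of_antitone (μ := μ) hBmeas
    (fun m n hmn x hx t ht => hx t (ht.trans hmn))
    (by
      filter_upwards [hT.symm.ae_exists_iterate_mem hs hs0] with x ⟨n, hn⟩
      exact ⟨n, fun h => h n le_rfl hn⟩) (half_pos hη)
  refine ⟨s ∪ B K, K, hs.union (hBmeas K), ?_, fun y => ?_⟩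
  · exact (measureReal_union_le _ _).trans_lt (by linarith)
  · by_cases hy : y ∈ B K
    · exact ⟨0, K.zero_le, Or.inr hy⟩
    · simp only [B, Set.mem_ofPred_eq, not_forall, not_not] at hy
      obtain ⟨t, ht, hyt⟩ := hy
      exact ⟨t, ht, Or.inl hyt⟩

end Selection

section Blocks

variable {ι : Type*}

/-- The word `v` labels the start of the orbit of `x`: the orbit follows the sets `A (v i)`, and
does not meet `F` at positive times before the length of `v`. -/
def Labels {X : Type*} (S : X → X) (A : ι → Set X) (F : Set X) (x : X) (v : List ι) : Prop :=
  ∀ i a, v[i]? = some a → S^[i] x ∈ A a ∧ (0 < i → S^[i] x ∉ F)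

theorem Labels.tail {X : Type*} {S : X → X} {A : ι → Set X} {F : Set X} {x : X} {v : List ι}
    (h : Labels S A F x v) : Labels S A F (S x) v.tail := by
  intro i a hi
  rw [List.getElem?_tail] at hi
  exact ⟨(h (i + 1) a hi).1, fun _ => (h (i + 1) a hi).2 i.succ_pos⟩

theorem measurableSet_labels {S : X → X} (hS : Measurable S) {A : ι → Set X}
    (hA : ∀ a, MeasurableSet (A a)) {F : Set X} (hF : MeasurableSet F) (v : List ι) :
    MeasurableSet {x | Labels S A F x v} := by
  have : {x | Labels S A F x v} = ⋂ i : Fin v.length,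
      (S^[i] ⁻¹' A v[i] ∩ {x | 0 < (i : ℕ) → S^[i] x ∉ F}) := by
    ext x
    simp only [Labels, Set.mem_ofPred_eq, Set.mem_iInter, Set.mem_inter_iff, Set.mem_preimage]
    constructor
    · exact fun h i => h i _ (List.getElem?_eq_getElem i.2)
    · intro h i a hi
      obtain ⟨hlt, rfl⟩ := List.getElem?_eq_some_iff.1 hi
      exact h ⟨i, hlt⟩
  rw [this]
  refine MeasurableSet.iInter fun i => ((hS.iterate i) (hA _)).inter ?_
  by_cases hi : 0 < (i : ℕ)
  · have : {x | 0 < (i : ℕ) → S^[i] x ∉ F} = S^[i] ⁻¹' Fᶜ := by ext x; simp [hi]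
    rw [this]
    exact (hS.iterate i) hF.compl
  · simp [hi]

/-- Concatenating the blocks `w` along orbits, restarting at visits to the marker `F`. -/
theorem exists_block_process [Countable ι] {T : X ≃ᵐ X} {A : ι → Set X} {F : Set X}
    (hF : MeasurableSet F) {K : ℕ} (hK : ∀ y, ∃ t ≤ K, T.symm^[t] y ∈ F) {w : X → List ι}
    (hw : DiscMeasurable w) (hw0 : ∀ x, w x ≠ []) (hwA : ∀ x, Labels T A F x (w x)) {L : ℕ}
    (hwL : ∀ x, (w x).length ≤ L) :
    ∃ z : X → List ι, DiscMeasurable z ∧ (∀ x, z x ≠ []) ∧ (∀ x, Labels T A F x (z x)) ∧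
      (∀ x, (z x).length ≤ L) ∧
      ∀ x, z (T x) = if (z x).tail = [] then w (T x) else (z x).tail := by
  let step : (X → List ι) → X → List ι := fun z y =>
    if y ∈ F ∨ (z (T.symm y)).tail = [] then w y else (z (T.symm y)).tail
  let zs : ℕ → X → List ι := fun n => step^[n] w
  have hzs : ∀ n, zs (n + 1) = step (zs n) := fun n => Function.iterate_succ_apply' _ _ _
  have hind : ∀ p : (X → List ι) → Prop, p w → (∀ z, p z → p (step z)) → ∀ n, p (zs n) := by
    intro p h0 h1 n
    induction n with
    | zero => exact h0
    | succ n ih => rw [hzs]; exact h1 _ ih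
  have hmeas : ∀ n, DiscMeasurable (zs n) := by
    refine hind _ hw fun z hz => ?_
    have hFm : DiscMeasurable fun x => x ∈ F := by
      refine .of_singleton fun p => ?_
      by_cases hp : p
      · have : (fun x => x ∈ F) ⁻¹' {p} = F := by ext x; simp [hp]
        rw [this]; exact hF
      · have : (fun x => x ∈ F) ⁻¹' {p} = Fᶜ := by ext x; simp [hp]
        rw [this]; exact hF.compl
    have h := hFm.prodMk (hw.prodMk (hz.comp_measurable T.symm.measurable))
    exact h.comp fun q => if q.1 ∨ q.2.2.tail = [] then q.2.1 else q.2.2.tail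
  have hstab : ∀ t n y, T.symm^[t] y ∈ F → t ≤ n → zs n y = zs t y := by
    intro t
    induction t with
    | zero =>
      intro n y hy _
      cases n with
      | zero => rfl
      | succ n =>
        rw [hzs]
        exact if_pos (Or.inl hy)
    | succ t ih =>
      intro n y hy hn
      cases n with
      | zero => omega
      | succ n =>
        rw [hzs, hzs]
        simp only [step]
        rw [ih n (T.symm y) hy (by omega)]
  have hfix : ∀ y, zs (K + 1) y = zs K y := by
    intro y
    obtain ⟨t, ht, hy⟩ := hK y
    rw [hstab t _ y hy (by omega), hstab t _ y hy ht]
  have hlab : ∀ x, Labels T A F x (zs K x) := by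
    refine hind (fun z => ∀ x, Labels T A F x (z x)) hwA (fun z hz x => ?_) K
    simp only [step]
    split_ifs
    · exact hwA x
    · simpa using (hz (T.symm x)).tail
  refine ⟨zs K, hmeas K, ?_, hlab, ?_, fun x => ?_⟩
  · refine hind (fun z => ∀ x, z x ≠ []) hw0 (fun z _ x => ?_) K
    simp only [step]
    split_ifs with h
    · exact hw0 x
    · exact fun h' => h (Or.inr h')
  · refine hind (fun z => ∀ x, (z x).length ≤ L) hwL (fun z hz x => ?_) K
    simp only [step]
    split_ifs
    · exact hwL x
    · rw [List.length_tail]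
      exact (Nat.sub_le _ _).trans (hz _)
  · rw [← hfix, hzs]
    simp only [step, T.symm_apply_apply]
    by_cases ht : (zs K x).tail = []
    · simp [ht]
    · have hTx : T x ∉ F := by
        obtain ⟨a, l, hl⟩ := List.exists_cons_of_ne_nil ht
        refine (hlab x 1 a ?_).2 one_pos
        rw [← List.getElem?_tail, hl]
        rfl
      simp [ht, hTx]

end Blocks

section Lower

variable {ι : Type*} [Fintype ι] {μ : Measure X} [IsProbabilityMeasure μ] {T : X ≃ᵐ X}
  {A : ι → Set X} {F : Set X}

/-- Transition weights of the process that, once the current word is exhausted, draws a new word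
from `Good` with weight `exp (-b * length)`, or an arbitrary single symbol. -/
noncomputable def blockKernel (Good : Finset (List ι)) (b : ℝ) (l l' : List ι) : ℝ :=
  if l.tail = [] then
    (if l' ∈ Good then Real.exp (-(b * l'.length)) else 0) +
      (if l'.length = 1 then (2 * Fintype.card ι : ℝ)⁻¹ else 0)
  else if l' = l.tail then 1 else 0

theorem blockKernel_nonneg (Good : Finset (List ι)) (b : ℝ) (l l' : List ι) :
    0 ≤ blockKernel Good b l l' := by
  unfold blockKernel
  split_ifs <;> positivity

theorem sum_blockKernel_le_one {Good : Finset (List ι)} {b : ℝ}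
    (hGood : ∑ v ∈ Good, Real.exp (-(b * v.length)) ≤ 1 / 2) (D : Finset (List ι)) (l : List ι) :
    ∑ l' ∈ D, blockKernel Good b l l' ≤ 1 := by
  unfold blockKernel
  by_cases hl : l.tail = []
  · simp only [hl, if_true]
    rw [Finset.sum_add_distrib, ← Finset.sum_filter, ← Finset.sum_filter]
    have h1 : ∑ v ∈ D with v ∈ Good, Real.exp (-(b * v.length)) ≤ 1 / 2 :=
      (Finset.sum_le_sum_of_subset_of_nonneg (fun v hv => (Finset.mem_filter.1 hv).2)
        fun _ _ _ => (Real.exp_pos _).le).trans hGood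
    have h2 : ((D.filter fun v => v.length = 1).card : ℝ) ≤ Fintype.card ι := by
      have : D.filter (fun v => v.length = 1) ⊆ Finset.univ.image fun a : ι => [a] := by
        intro v hv
        obtain ⟨a, rfl⟩ := List.length_eq_one_iff.1 (Finset.mem_filter.1 hv).2
        simp
      exact_mod_cast (Finset.card_le_card this).trans Finset.card_image_le
    rw [Finset.sum_const, nsmul_eq_mul]
    have h3 : (Fintype.card ι : ℝ) * (2 * Fintype.card ι : ℝ)⁻¹ ≤ 1 / 2 := by
      rcases eq_or_ne (Fintype.card ι : ℝ) 0 with h | h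
      · simp [h]
      · field_simp
        exact le_rfl
    have h4 := mul_le_mul_of_nonneg_right h2
      (by positivity : (0 : ℝ) ≤ (2 * Fintype.card ι : ℝ)⁻¹)
    linarith
  · simp only [hl, if_false]
    rw [Finset.sum_ite_eq']
    split_ifs <;> norm_num

theorem blockKernel_cost {Good : Finset (List ι)} {b : ℝ} (hb : 0 ≤ b) (hι : 0 < Fintype.card ι)
    {l l' w : List ι} (hl : l ≠ []) (hw : w ∈ Good ∨ w.length = 1)
    (hl' : l' = if l.tail = [] then w else l.tail) :
    0 < blockKernel Good b l l' ∧ -Real.log (blockKernel Good b l l') ≤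
      b * (1 + l'.length - l.length) +
        Real.log (2 * Fintype.card ι) * if w ∈ Good then 0 else 1 := by
  have hι' : (1 : ℝ) ≤ Fintype.card ι := Nat.one_le_cast.2 hι
  have hC : 0 ≤ Real.log (2 * Fintype.card ι) := Real.log_nonneg (by linarith)
  have hpos1 : 0 < l.length := List.length_pos_iff.2 hl
  unfold blockKernel
  by_cases ht : l.tail = []
  · have hlen : l.length = 1 := by
      have := congrArg List.length ht
      simp only [List.length_tail, List.length_nil] at this
      omega
    rw [if_pos ht] at hl'
    subst hl'
    rw [if_pos ht, hlen]
    by_cases hG : l' ∈ Good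
    · simp only [hG, if_true]
      have hge : Real.exp (-(b * l'.length)) ≤ Real.exp (-(b * l'.length)) +
          (if l'.length = 1 then (2 * Fintype.card ι : ℝ)⁻¹ else 0) :=
        le_add_of_nonneg_right (by split_ifs <;> positivity)
      refine ⟨(Real.exp_pos _).trans_le hge, ?_⟩
      have := Real.log_le_log (Real.exp_pos _) hge
      rw [Real.log_exp] at this
      push_cast
      linarith
    · have h1 : l'.length = 1 := hw.resolve_left hG
      simp only [hG, if_false, h1, if_true, zero_add]
      refine ⟨by positivity, ?_⟩
      rw [Real.log_inv]
      push_cast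
      linarith
  · rw [if_neg ht] at hl'
    subst hl'
    rw [if_neg ht, if_pos rfl, Real.log_one, List.length_tail, Nat.cast_sub hpos1]
    refine ⟨one_pos, ?_⟩
    have : 0 ≤ Real.log (2 * Fintype.card ι) * if w ∈ Good then 0 else 1 :=
      mul_nonneg hC (by split_ifs <;> norm_num)
    push_cast
    linarith

/-- If most orbits start with a word from a list of small exponential weight, then some partition
refining the cover has small entropy. -/
theorem hPlusC_le_of_blocks (hT : MeasurePreserving T μ μ) {U : Finset (Set X)}
    (hAU : ∀ a, A a ∈ U) (hF : MeasurableSet F) {K : ℕ}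
    (hK : ∀ y, ∃ t ≤ K, T.symm^[t] y ∈ F) {Good : Finset (List ι)} {b : ℝ} (hb : 0 ≤ b)
    (hGood : ∑ v ∈ Good, Real.exp (-(b * v.length)) ≤ 1 / 2) {w : X → List ι}
    (hw : DiscMeasurable w) (hw0 : ∀ x, w x ≠ []) (hwA : ∀ x, Labels T A F x (w x))
    (hwGood : ∀ x, w x ∈ Good ∨ (w x).length = 1) :
    hPlusC μ T U ≤ b + Real.log (2 * Fintype.card ι) * μ.real {x | w x ∉ Good} := by
  set L := Good.sup List.length + 1
  have hwL : ∀ x, (w x).length ≤ L := fun x => by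
    rcases hwGood x with h | h
    · exact (Finset.le_sup (f := List.length) h).trans (Nat.le_succ _)
    · rw [h]
      exact Nat.succ_le_succ (Nat.zero_le _)
  obtain ⟨z, hz, hz0, hzA, hzL, hzT⟩ := exists_block_process hF hK hw hw0 hwA hwL
  have hfin := List.finite_length_le ι L
  let D : Finset (List ι) := hfin.toFinset
  let z' : X → D := fun x => ⟨z x, hfin.mem_toFinset.2 (hzL x)⟩
  have hz' : DiscMeasurable z' := .of_singleton fun l => by
    have : z' ⁻¹' {l} = z ⁻¹' {l.1} := by
      ext x
      simp [z', Subtype.ext_iff]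
    rw [this]
    exact hz _
  obtain ⟨x₀⟩ : Nonempty X := nonempty_of_neBot (ae μ)
  obtain ⟨a₀, -, -⟩ := List.exists_cons_of_ne_nil (hw0 x₀)
  have hι : 0 < Fintype.card ι := Fintype.card_pos_iff.2 ⟨a₀⟩
  have hU : ∀ l, ∃ B ∈ U, z' ⁻¹' {l} ⊆ B := by
    rintro ⟨l, hl⟩
    cases l with
    | nil =>
      exact ⟨A a₀, hAU _, fun x hx => absurd (congrArg Subtype.val hx) (hz0 x)⟩
    | cons a l =>
      refine ⟨A a, hAU _, fun x hx => ?_⟩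
      have hx' : z x = a :: l := congrArg Subtype.val hx
      exact (hzA x 0 a (by rw [hx']; rfl)).1
  have hcost := fun x => blockKernel_cost hb hι (hz0 x) (hwGood (T x)) (hzT x)
  refine (hPlusC_le_hPart hT hz' hU).trans ((hPart_fiberPartition_le_integral hT hz'
    (fun l l' => blockKernel Good b l.1 l'.1) (fun _ _ => blockKernel_nonneg _ _ _ _)
    (fun l => ?_) fun x => (hcost x).1).trans ?_)
  · rw [Finset.sum_coe_sort D fun l' => blockKernel Good b l.1 l']
    exact sum_blockKernel_le_one hGood D l
  · have hlen : Integrable (fun x => ((z x).length : ℝ)) μ :=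
      hz'.integrable_comp fun l => (l.1.length : ℝ)
    have hlenT : Integrable (fun x => ((z (T x)).length : ℝ)) μ :=
      (hz'.comp_measurable T.measurable).integrable_comp fun l => (l.1.length : ℝ)
    set bad : X → ℝ := fun x => if w x ∈ Good then 0 else 1
    have hbad_eq : bad = {x | w x ∉ Good}.indicator fun _ => 1 := by
      ext x
      by_cases h : w x ∈ Good <;> simp [bad, h]
    have hmeasbad : MeasurableSet {x | w x ∉ Good} := hw {l | l ∉ Good}
    have hbad : Integrable bad μ := by
      rw [hbad_eq]
      exact (integrable_const _).indicator hmeasbad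
    have hbadT : Integrable (fun x => bad (T x)) μ := hT.integrable_comp_of_integrable hbad
    have hpair := hz'.prodMk (hz'.comp_measurable T.measurable)
    have e1 : ∫ x, ((z (T x)).length : ℝ) ∂μ = ∫ x, ((z x).length : ℝ) ∂μ :=
      hT.integral_comp' fun x => ((z x).length : ℝ)
    have e2 : ∫ x, bad (T x) ∂μ = μ.real {x | w x ∉ Good} := by
      rw [hT.integral_comp' bad, hbad_eq, integral_indicator_const _ hmeasbad]
      simp
    have i1 : Integrable (fun x => 1 + ((z (T x)).length : ℝ)) μ := (integrable_const _).add hlenT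
    have i2 : Integrable (fun x => 1 + ((z (T x)).length : ℝ) - (z x).length) μ := i1.sub hlen
    calc _ ≤ ∫ x, (b * (1 + (z (T x)).length - (z x).length) +
            Real.log (2 * Fintype.card ι) * bad (T x)) ∂μ :=
          integral_mono
            (hpair.integrable_comp fun p => -Real.log (blockKernel Good b p.1.1 p.2.1))
            ((i2.const_mul _).add (hbadT.const_mul _))
            fun x => (hcost x).2
      _ = _ := by
          rw [integral_add (i2.const_mul _) (hbadT.const_mul _), integral_const_mul,
            integral_const_mul, integral_sub i1 hlen, integral_add (integrable_const _) hlenT, e1, e2]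
          simp

end Lower

section Words

variable {ι : Type*}

theorem Labels.append {X : Type*} {S : X → X} {A : ι → Set X} {x : X} {u v : List ι}
    (hu : Labels S A ∅ x u) (hv : Labels S A ∅ (S^[u.length] x) v) : Labels S A ∅ x (u ++ v) := by
  intro i a hi
  refine ⟨?_, fun _ => Set.notMem_empty _⟩
  rcases lt_or_ge i u.length with h | h
  · rw [List.getElem?_append_left h] at hi
    exact (hu i a hi).1
  · rw [List.getElem?_append_right h] at hi
    have := (hv _ a hi).1
    rwa [← Function.iterate_add_apply, Nat.sub_add_cancel h] at this

theorem exists_labels_ofFn {X : Type*} (S : X → X) {A : ι → Set X} (hcov : ∀ x, ∃ a, x ∈ A a)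
    (x : X) (n : ℕ) : ∃ v : Fin n → ι, Labels S A ∅ x (List.ofFn v) := by
  choose f hf using hcov
  refine ⟨fun i => f (S^[i] x), fun i a hi => ⟨?_, fun _ => Set.notMem_empty _⟩⟩
  rw [List.getElem?_ofFn] at hi
  split_ifs at hi with h
  rw [← Option.some.inj hi]
  exact hf _

variable [Fintype ι]

/-- Words of the form `u ++ v` with `v ∈ Λ n`, where `u` has length `j < K` and `L j ≤ n < K`. -/
noncomputable def paddedWords (Λ : ℕ → Finset (List ι)) (L : ℕ → ℕ) (K : ℕ) :
    Finset (List ι) :=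
  (Finset.range K).biUnion fun j => (Finset.Ico (L j) K).biUnion fun n =>
    ((Finset.univ : Finset (Fin j → ι)) ×ˢ Λ n).image fun p => List.ofFn p.1 ++ p.2

theorem mem_paddedWords {Λ : ℕ → Finset (List ι)} {L : ℕ → ℕ} {K : ℕ} {w : List ι} :
    w ∈ paddedWords Λ L K ↔ ∃ j < K, ∃ n, L j ≤ n ∧ n < K ∧
      ∃ u : Fin j → ι, ∃ v ∈ Λ n, List.ofFn u ++ v = w := by
  simp [paddedWords, and_assoc]

theorem sum_biUnion_le_sum {κ β : Type*} [DecidableEq β] (s : Finset κ) (t : κ → Finset β)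
    {f : β → ℝ} (hf : ∀ x, 0 ≤ f x) : ∑ x ∈ s.biUnion t, f x ≤ ∑ i ∈ s, ∑ x ∈ t i, f x := by
  induction s using Finset.induction_on with
  | empty => simp
  | insert a s ha ih =>
    rw [Finset.biUnion_insert, Finset.sum_insert ha]
    have := Finset.sum_union_inter (s₁ := t a) (s₂ := s.biUnion t) (f := f)
    have h0 : 0 ≤ ∑ x ∈ t a ∩ s.biUnion t, f x := Finset.sum_nonneg fun x _ => hf x
    linarith

theorem exists_sum_paddedWords_le {Λ : ℕ → Finset (List ι)} {a δ : ℝ} (ha : 0 ≤ a) (hδ : 0 < δ)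
    (hlen : ∀ n, ∀ v ∈ Λ n, v.length = n) (hcard : ∀ n, ((Λ n).card : ℝ) ≤ Real.exp (n * a)) :
    ∃ L : ℕ → ℕ, (∀ j, 1 ≤ L j) ∧
      ∀ K, ∑ w ∈ paddedWords Λ L K, Real.exp (-((a + δ) * w.length)) ≤ 1 / 2 := by
  set r := Real.exp (-δ) with hr
  have hr0 : 0 < r := Real.exp_pos _
  have hr1 : r < 1 := Real.exp_zero ▸ Real.exp_lt_exp.2 (neg_lt_zero.2 hδ)
  have hL : ∀ j : ℕ, ∃ L : ℕ, 1 ≤ L ∧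
      (Fintype.card ι : ℝ) ^ j * (r ^ L / (1 - r)) ≤ (1 / 2 : ℝ) ^ (j + 2) := by
    intro j
    have h : Tendsto (fun L : ℕ => (Fintype.card ι : ℝ) ^ j * (r ^ L / (1 - r))) atTop (𝓝 0) := by
      simpa using ((tendsto_pow_atTop_nhds_zero_of_lt_one hr0.le hr1).div_const
        (1 - r)).const_mul ((Fintype.card ι : ℝ) ^ j)
    obtain ⟨L, h1, h2⟩ := ((eventually_ge_atTop 1).and
      (h.eventually_le_const (by positivity : (0 : ℝ) < (1 / 2) ^ (j + 2)))).exists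
    exact ⟨L, h1, h2⟩
  choose L hL1 hL using hL
  refine ⟨L, hL1, fun K => ?_⟩
  have hterm : ∀ j n, ∑ w ∈ ((Finset.univ : Finset (Fin j → ι)) ×ˢ Λ n).image
      (fun p => List.ofFn p.1 ++ p.2), Real.exp (-((a + δ) * w.length)) ≤
      (Fintype.card ι : ℝ) ^ j * r ^ n := by
    intro j n
    set G := ((Finset.univ : Finset (Fin j → ι)) ×ˢ Λ n).image (fun p => List.ofFn p.1 ++ p.2)
    have hG : (G.card : ℝ) ≤ (Fintype.card ι : ℝ) ^ j * Real.exp (n * a) := by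
      have h1 : G.card ≤ Fintype.card ι ^ j * (Λ n).card := by
        refine Finset.card_image_le.trans_eq ?_
        simp
      refine (Nat.cast_le.2 h1).trans ?_
      push_cast
      exact mul_le_mul_of_nonneg_left (hcard n) (by positivity)
    have hGw : ∀ w ∈ G, Real.exp (-((a + δ) * w.length)) ≤ Real.exp (-((a + δ) * n)) := by
      intro w hw
      obtain ⟨⟨u, v⟩, huv, rfl⟩ := Finset.mem_image.1 hw
      have hv := hlen n v (Finset.mem_product.1 huv).2
      refine Real.exp_le_exp.2 (neg_le_neg (mul_le_mul_of_nonneg_left ?_ (by linarith)))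
      rw [List.length_append, hv]
      exact_mod_cast Nat.le_add_left _ _
    calc _ ≤ (G.card : ℝ) * Real.exp (-((a + δ) * n)) := by
          rw [← nsmul_eq_mul]
          exact Finset.sum_le_card_nsmul _ _ _ hGw
      _ ≤ (Fintype.card ι : ℝ) ^ j * Real.exp (n * a) * Real.exp (-((a + δ) * n)) := by gcongr
      _ = (Fintype.card ι : ℝ) ^ j * r ^ n := by
          rw [mul_assoc, ← Real.exp_add, hr, ← Real.exp_nat_mul]
          ring_nf
  calc _ ≤ ∑ j ∈ Finset.range K, ∑ n ∈ Finset.Ico (L j) K, (Fintype.card ι : ℝ) ^ j * r ^ n := by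
        rw [paddedWords]
        refine (sum_biUnion_le_sum _ _ fun _ => (Real.exp_pos _).le).trans ?_
        refine Finset.sum_le_sum fun j _ => ?_
        refine (sum_biUnion_le_sum _ _ fun _ => (Real.exp_pos _).le).trans ?_
        exact Finset.sum_le_sum fun n _ => hterm j n
    _ ≤ ∑ j ∈ Finset.range K, (1 / 2 : ℝ) ^ (j + 2) := by
        refine Finset.sum_le_sum fun j _ => ?_
        rw [← Finset.mul_sum]
        refine (mul_le_mul_of_nonneg_left (geom_sum_Ico_le_of_lt_one hr0.le hr1)
          (by positivity)).trans (hL j)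
    _ = (1 / 4) * ∑ j ∈ Finset.range K, (1 / 2 : ℝ) ^ j := by
        rw [Finset.mul_sum]
        exact Finset.sum_congr rfl fun j _ => by rw [pow_add]; ring
    _ ≤ 1 / 4 * 2 := by
        gcongr
        exact sum_geometric_two_le K
    _ = 1 / 2 := by norm_num

variable {μ : Measure X} [IsProbabilityMeasure μ] {T : X ≃ᵐ X} {A : ι → Set X}

/-- If for infinitely many lengths `n` a list of about `exp (n * a)` words labels the orbits of a
nonnegligible set of points, then the entropy of the cover is at most `a`. -/
theorem hPlusC_le_of_frequently_words (hT : Ergodic T μ)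
    (hsmall : ∀ δ > 0, ∃ s, MeasurableSet s ∧ μ s ≠ 0 ∧ μ.real s < δ)
    (hA : ∀ i, MeasurableSet (A i)) (hcov : ∀ x, ∃ i, x ∈ A i) {U : Finset (Set X)}
    (hAU : ∀ i, A i ∈ U) {Λ : ℕ → Finset (List ι)} {a c : ℝ} (ha : 0 ≤ a) (hc : 0 < c)
    (hlen : ∀ n, ∀ v ∈ Λ n, v.length = n) (hcard : ∀ n, ((Λ n).card : ℝ) ≤ Real.exp (n * a))
    (hfreq : ∃ᶠ n in atTop, c ≤ μ.real {x | ∃ v ∈ Λ n, Labels T A ∅ x v}) :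
    hPlusC μ T U ≤ a := by
  have hmp := hT.toMeasurePreserving
  have hlab : ∀ {F : Set X}, MeasurableSet F → ∀ v, MeasurableSet {x | Labels T A F x v} :=
    fun hF => measurableSet_labels T.measurable hA hF
  have hlabs : ∀ {F : Set X}, MeasurableSet F → ∀ G : Finset (List ι),
      MeasurableSet {x | ∃ v ∈ G, Labels T A F x v} := by
    intro F hF G
    have : {x | ∃ v ∈ G, Labels T A F x v} = ⋃ v ∈ G, {x | Labels T A F x v} := by ext; simp
    rw [this]
    exact G.measurableSet_biUnion fun v _ => hlab hF v
  set E : Set X := {x | ∀ N, ∃ n ≥ N, ∃ v ∈ Λ n, Labels T A ∅ x v} with hE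
  set tail : ℕ → Set X := fun N => {x | ∃ n ≥ N, ∃ v ∈ Λ n, Labels T A ∅ x v} with htail
  have htail_meas : ∀ N, MeasurableSet (tail N) := by
    intro N
    have : tail N = ⋃ n ∈ Set.Ici N, {x | ∃ v ∈ Λ n, Labels T A ∅ x v} := by ext; simp [tail]
    rw [this]
    exact MeasurableSet.biUnion (Set.to_countable _) fun n _ => hlabs .empty _
  have hE_meas : MeasurableSet E := by
    have : E = ⋂ N, tail N := by ext; simp [E, tail]
    rw [this]
    exact MeasurableSet.iInter htail_meas
  have hE0 : μ E ≠ 0 := by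
    intro h0
    obtain ⟨N, hN⟩ := exists_measureReal_lt_of_antitone (μ := μ) htail_meas
      (fun M N hMN x ⟨n, hn, hx⟩ => ⟨n, hMN.trans hn, hx⟩)
      (by
        filter_upwards [measure_eq_zero_iff_ae_notMem.1 h0] with x hx
        simpa [E, tail] using hx) hc
    obtain ⟨n, hn, hcn⟩ := (hfreq.and_eventually (eventually_ge_atTop N)).exists
    exact hN.not_ge (hn.trans (measureReal_mono fun x hx => ⟨n, hcn, hx⟩))
  have hC : 0 ≤ Real.log (2 * Fintype.card ι) := by
    exact_mod_cast Real.log_natCast_nonneg (2 * Fintype.card ι)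
  set C := Real.log (2 * Fintype.card ι)
  refine le_of_forall_pos_le_add fun e he => ?_
  set η := e / (1 + 2 * C) with hη_def
  have hη : 0 < η := by positivity
  obtain ⟨L, hL1, hL⟩ := exists_sum_paddedWords_le ha hη hlen hcard
  have hmono : ∀ {M N : ℕ}, M ≤ N → paddedWords Λ L M ⊆ paddedWords Λ L N := by
    intro M N hMN w hw
    rw [mem_paddedWords] at hw ⊢
    obtain ⟨j, hj, n, hn, hnM, hw⟩ := hw
    exact ⟨j, hj.trans_le hMN, n, hn, hnM.trans_le hMN, hw⟩
  obtain ⟨K, hK⟩ := exists_measureReal_lt_of_antitone (μ := μ)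
    (B := fun K => {x | ∃ v ∈ paddedWords Λ L K, Labels T A ∅ x v}ᶜ)
    (fun K => (hlabs .empty _).compl)
    (fun M N hMN x hx hxM => hx (hxM.imp fun v hv => ⟨hmono hMN hv.1, hv.2⟩))
    (by
      filter_upwards [hT.ae_exists_iterate_mem hE_meas hE0] with x ⟨j, hj⟩
      obtain ⟨n, hn, v, hv, hxv⟩ := hj (L j)
      obtain ⟨u, hu⟩ := exists_labels_ofFn T hcov x j
      refine ⟨j + n + 1, fun h => h ⟨List.ofFn u ++ v, ?_, hu.append (by simpa using hxv)⟩⟩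
      exact mem_paddedWords.2 ⟨j, by omega, n, hn, by omega, u, v, hv, rfl⟩) hη
  set Good := paddedWords Λ L K
  set M := Good.sup List.length
  obtain ⟨F, R, hF, hFη, hR⟩ := exists_marker hT hsmall (div_pos hη (M.cast_add_one_pos (α := ℝ)))
  set D : Set X := {x | ∃ v ∈ Good, Labels T A F x v}ᶜ with hD
  have hDmeas : MeasurableSet D := (hlabs hF _).compl
  have hDη : μ.real D ≤ 2 * η := by
    have hsub : D ⊆ {x | ∃ v ∈ Good, Labels T A ∅ x v}ᶜ ∪
        ⋃ i ∈ Finset.range M, T^[i] ⁻¹' F := by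
      intro x hx
      by_contra hcon
      simp only [Set.mem_union, Set.mem_compl_iff, Set.mem_iUnion, not_or, not_not,
        not_exists] at hcon
      obtain ⟨⟨v, hv, hxv⟩, hxF⟩ := hcon
      refine hx ⟨v, hv, fun i s hi => ⟨(hxv i s hi).1, fun _ => hxF i ?_⟩⟩
      obtain ⟨hlt, -⟩ := List.getElem?_eq_some_iff.1 hi
      exact Finset.mem_range.2 (hlt.trans_le (Finset.le_sup (f := List.length) hv))
    have hU : μ.real (⋃ i ∈ Finset.range M, T^[i] ⁻¹' F) ≤ η := by
      refine (measureReal_biUnion_finset_le _ _).trans ?_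
      have : ∀ i, μ.real (T^[i] ⁻¹' F) = μ.real F := fun i =>
        (hmp.iterate i).measureReal_preimage hF.nullMeasurableSet
      simp only [this, Finset.sum_const, Finset.card_range, nsmul_eq_mul]
      have hM : (0 : ℝ) < M + 1 := M.cast_add_one_pos
      rw [lt_div_iff₀ hM] at hFη
      nlinarith [measureReal_nonneg (μ := μ) (s := F)]
    refine (measureReal_mono hsub).trans ((measureReal_union_le _ _).trans ?_)
    linarith
  obtain ⟨w, hw, hwE⟩ := exists_discMeasurable_selection
    (fun v : List ι => {x | Labels T A F x v} ∩
      {x | v ≠ [] ∧ (v ∈ Good ∨ v.length = 1 ∧ x ∈ D)})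
    (by
      intro v
      refine (hlab hF v).inter ?_
      by_cases h0 : v = []
      · simp [h0]
      by_cases h1 : v ∈ Good
      · simp [h0, h1]
      by_cases h2 : v.length = 1
      · simpa [h0, h1, h2] using hDmeas
      · simp [h1, h2])
    (by
      intro x
      by_cases hx : x ∈ D
      · obtain ⟨s, hs⟩ := hcov x
        refine ⟨[s], fun i t hi => ?_, by simp, Or.inr ⟨rfl, hx⟩⟩
        obtain ⟨hlt, rfl⟩ := List.getElem?_eq_some_iff.1 hi
        obtain rfl : i = 0 := by simpa using hlt
        exact ⟨hs, fun h => absurd h (lt_irrefl 0)⟩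
      · obtain ⟨v, hv, hxv⟩ : ∃ v ∈ Good, Labels T A F x v := not_not.1 hx
        refine ⟨v, hxv, ?_, Or.inl hv⟩
        rintro rfl
        obtain ⟨j, -, n, hn, -, u, v, hv', huv⟩ := mem_paddedWords.1 hv
        have hv0 : v = [] := (List.append_eq_nil_iff.1 huv).2
        have := hlen n v hv'
        have := hL1 j
        simp only [hv0, List.length_nil] at *
        omega)
  have hbad : μ.real {x | w x ∉ Good} ≤ 2 * η :=
    (measureReal_mono fun x hx => ((hwE x).2.2.resolve_left hx).2).trans hDη
  calc hPlusC μ T U ≤ a + η + C * μ.real {x | w x ∉ Good} :=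
        hPlusC_le_of_blocks hmp hAU hF hR (by linarith) (hL K) hw (fun x => (hwE x).2.1)
          (fun x => (hwE x).1) fun x => (hwE x).2.2.imp_right And.left
    _ ≤ a + η + C * (2 * η) := by gcongr
    _ = a + η * (1 + 2 * C) := by ring
    _ = a + e := by rw [hη_def, div_mul_cancel₀ _ (by positivity)]

end Words

section Main

variable {μ : Measure X} [IsProbabilityMeasure μ] {U : Finset (Set X)}

theorem IsMCover.exists_mem_subtype (hU : IsMCover U) (x : X) : ∃ A : U, x ∈ A.1 := by
  obtain ⟨A, hA, hx⟩ : x ∈ ⋃₀ (U : Set (Set X)) := hU.2 ▸ Set.mem_univ x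
  exact ⟨⟨A, hA⟩, hx⟩

theorem IsMCover.exists_selection (hU : IsMCover U) :
    ∃ f : X → U, DiscMeasurable f ∧ ∀ i, ∃ B ∈ U, f ⁻¹' {i} ⊆ B := by
  obtain ⟨f, hf, hfU⟩ := exists_discMeasurable_selection (fun A : U => A.1) (fun A => hU.1 _ A.2)
    hU.exists_mem_subtype
  refine ⟨f, hf, fun i => ⟨i, i.2, fun x hx => ?_⟩⟩
  rw [← show f x = i from hx]
  exact hfU x

/-- The minimum defining `covN` is attained, by cylinders coded by words. -/
theorem exists_words_of_covN {S : X → X} (hU : IsMCover U) (n : ℕ) {ε : ℝ} (hε : 0 < ε) :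
    ∃ Λ : Finset (List U), (∀ v ∈ Λ, v.length = n) ∧ Λ.card ≤ covN μ (joinN S U n) ε ∧
      1 - ε < μ.real {x | ∃ v ∈ Λ, Labels S Subtype.val ∅ x v} := by
  have hne : {m | ∃ W ⊆ joinN S U n, W.card = m ∧
      1 - ε < (μ (⋃₀ (W : Set (Set X)))).toReal}.Nonempty := by
    refine ⟨_, joinN S U n, subset_rfl, rfl, ?_⟩
    have : ⋃₀ (joinN S U n : Set (Set X)) = Set.univ := by
      refine Set.eq_univ_of_forall fun x => ?_
      choose v hv using fun i : Fin n => hU.exists_mem_subtype (S^[i] x)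
      exact ⟨_, Finset.mem_coe.2 (mem_joinN_iff.2 ⟨v, rfl⟩), hv⟩
    rw [this, measure_univ, ENNReal.toReal_one]
    linarith
  obtain ⟨W, hW, hWcard, hWμ⟩ := Nat.sInf_mem hne
  choose v hv using fun s : W => mem_joinN_iff.1 (hW s.2)
  refine ⟨W.attach.image fun s => List.ofFn (v s), ?_, ?_, hWμ.trans_le ?_⟩
  · intro l hl
    obtain ⟨s, -, rfl⟩ := Finset.mem_image.1 hl
    exact List.length_ofFn
  · exact Finset.card_image_le.trans_eq (W.card_attach.trans hWcard)
  · refine measureReal_mono ?_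
    rintro x ⟨s, hs, hx⟩
    refine ⟨_, Finset.mem_image_of_mem _ (W.mem_attach ⟨s, hs⟩),
      fun i a hi => ⟨?_, fun _ => Set.notMem_empty _⟩⟩
    rw [List.getElem?_ofFn] at hi
    split_ifs at hi with h
    rw [← Option.some.inj hi]
    rw [show s = _ from hv ⟨s, hs⟩] at hx
    exact hx ⟨i, h⟩

theorem hPlusC_le_zero_of_forall_le {S : X → X} (hS : MeasurePreserving S μ μ) (hU : IsMCover U)
    {m : ℝ} (hm : 0 < m) (h : ∀ s, MeasurableSet s → μ.real s ≠ 0 → m ≤ μ.real s) :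
    hPlusC μ S U ≤ 0 := by
  obtain ⟨f, hf, hfU⟩ := hU.exists_selection
  refine (hPlusC_le_hPart hS hf hfU).trans ?_
  refine le_of_tendsto_of_tendsto' (tendsto_funEntropy_itinerary_div hf hS)
    (tendsto_const_div_atTop_nhds_zero_nat (-Real.log m)) fun n => ?_
  gcongr
  exact funEntropy_le_of_forall_le_measureReal (hf.itinerary hS.measurable n) hm h

theorem hPlusC_le_of_frequently_covN {T : X ≃ᵐ X} (hT : Ergodic T μ) (hU : IsMCover U)
    {ε : ℝ} (hε : 0 < ε) (hε1 : ε < 1) {a : ℝ}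
    (hfreq : ∃ᶠ n : ℕ in atTop, Real.log (covN μ (joinN T U n) ε) / n ≤ a) :
    hPlusC μ T U ≤ a := by
  have ha : 0 ≤ a := by
    obtain ⟨n, hn⟩ := hfreq.exists
    exact (div_nonneg (Real.log_natCast_nonneg _) n.cast_nonneg).trans hn
  by_cases hsmall : ∀ δ > 0, ∃ s, MeasurableSet s ∧ μ s ≠ 0 ∧ μ.real s < δ
  · choose Λ hlen hcard hμ using fun n => exists_words_of_covN (μ := μ) (S := T) hU n hε
    set Λ' : ℕ → Finset (List U) :=
      fun n => if ((Λ n).card : ℝ) ≤ Real.exp (n * a) then Λ n else ∅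
    refine hPlusC_le_of_frequently_words (A := Subtype.val) (Λ := Λ') hT hsmall
      (fun A => hU.1 _ A.2) hU.exists_mem_subtype (fun A => A.2) ha (sub_pos.2 hε1) ?_ ?_ ?_
    · intro n v hv
      simp only [Λ'] at hv
      split_ifs at hv
      · exact hlen n v hv
      · exact absurd hv (Finset.notMem_empty _)
    · intro n
      simp only [Λ']
      split_ifs with h
      · exact h
      · simpa using (Real.exp_pos _).le
    · refine (hfreq.and_eventually (eventually_gt_atTop 0)).mono fun n ⟨hn, hn0⟩ => ?_
      have h : ((Λ n).card : ℝ) ≤ Real.exp (n * a) := by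
        rcases Nat.eq_zero_or_pos (Λ n).card with h0 | h0
        · rw [h0]
          simpa using (Real.exp_pos _).le
        · rw [div_le_iff₀ (Nat.cast_pos.2 hn0)] at hn
          rw [← Real.log_le_iff_le_exp (Nat.cast_pos.2 h0), mul_comm]
          exact (Real.log_le_log (Nat.cast_pos.2 h0) (Nat.cast_le.2 (hcard n))).trans hn
      simp only [Λ', if_pos h]
      exact (hμ n).le
  · push Not at hsmall
    obtain ⟨m, hm, h⟩ := hsmall
    refine (hPlusC_le_zero_of_forall_le hT.toMeasurePreserving hU hm fun s hs hs0 => ?_).trans ha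
    exact h s hs fun h0 => hs0 (by rw [measureReal_def, h0, ENNReal.toReal_zero])

theorem eventually_log_covN_div_le_of_hPlusC_lt {S : X → X} (hS : Ergodic S μ)
    (hU : IsMCover U) {ε : ℝ} (hε : 0 < ε) {b : ℝ} (hb : hPlusC μ S U < b) :
    ∀ᶠ n : ℕ in atTop, Real.log (covN μ (joinN S U n) ε) / n ≤ b := by
  have hne : {h | ∃ α, IsMPartition α ∧ Refines α U ∧ h = hPart μ S α}.Nonempty := by
    obtain ⟨f, hf, hfU⟩ := hU.exists_selection
    exact ⟨_, fiberPartition f, isMPartition_fiberPartition hf,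
      refines_fiberPartition_iff.2 hfU, rfl⟩
  obtain ⟨_, ⟨α, hα, hαU, rfl⟩, hlt⟩ := exists_lt_of_csInf_lt hne hb
  obtain ⟨f, hf, hfα, -⟩ := hα.exists_fiberPartition_eq
  rw [← hfα] at hlt hαU
  exact eventually_log_covN_div_le hS hf (refines_fiberPartition_iff.1 hαU) hε hlt

end Main

/-- For an ergodic m.t.d.s. `(X, 𝓑, μ, T)` and a cover `𝓤`,
`h_μᵉ(𝓤, T) = h_μ⁺(𝓤, T)`; i.e. for any `0 < ε < 1`, the sequence
`(1/n)·log 𝓝(𝓤₀^{n−1}, ε)` converges to `h_μ⁺(𝓤, T)`. -/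
theorem hE_eq_hPlus {X : Type*} [MeasurableSpace X] [StandardBorelSpace X]
    (μ : Measure X) [IsProbabilityMeasure μ] (T : X ≃ᵐ X)
    (herg : Ergodic ⇑T μ)
    (U : Finset (Set X)) (hU : IsMCover U) :
    ∀ ε : ℝ, 0 < ε → ε < 1 →
      Tendsto (fun n : ℕ => Real.log (covN μ (joinN ⇑T U n) ε) / n) atTop
        (𝓝 (hPlusC μ ⇑T U)) := by
  intro ε hε hε1
  refine tendsto_order.2 ⟨fun a ha => ?_, fun b hb => ?_⟩
  · by_contra h
    refine ha.not_ge (hPlusC_le_of_frequently_covN herg hU hε hε1 ?_)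
    simpa only [Filter.Frequently, not_le] using h
  · obtain ⟨c, hc, hcb⟩ := exists_between hb
    exact (eventually_log_covN_div_le_of_hPlusC_lt herg hU hε hc).mono fun n hn => hn.trans_lt hcb
end

section
/- Let Λ be a finite alphabet of M letters, n ≥ 1, Γ = Λⁿ, and let μ be a probability distribution on Γ with average entropy h₀ = −(1/n)·∑_{γ∈Γ} μ(γ)·log₂ μ(γ). Then there exists a positive function φ(δ) with φ(δ) → 0 as δ → 0 such that for every 0 < δ < 1/2 and every k > n, the number of words ω ∈ Λ^k which are (n, k, δ, μ) is at most 2^{k(h₀ + φ(δ))}. -/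
open Filter Topology

/-- A word `ω ∈ Λ^k` is `(n, k, δ, μ)`: there is an `(n, k, δ)`-packing
`𝓒 = (i₀,…,i_{m−1}; γ₀,…,γ_{m−1})` for `ω` whose induced distribution `P_𝓒` on
`Γ = Λⁿ` satisfies `‖μ − P_𝓒‖ < δ`. -/
def IsPackedWord (Λ : Type*) (n k : ℕ) (δ : ℝ) (μ : (Fin n → Λ) → ℝ)
    (ω : Fin k → Λ) : Prop :=
  ∃ (m : ℕ) (i : Fin m → ℕ) (γ : Fin m → (Fin n → Λ)),
    (∀ j, i j ≤ k - n) ∧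
    (∀ j₁ j₂ : Fin m, j₁ < j₂ → i j₁ + n ≤ i j₂) ∧
    1 - δ < ((m : ℝ) * n) / k ∧
    (∀ (j : Fin m) (t : ℕ) (ht : t < n) (hk : i j + t < k),
      ω ⟨i j + t, hk⟩ = γ j ⟨t, ht⟩) ∧
    ∀ g : Fin n → Λ, |(Nat.card {j : Fin m // γ j = g} : ℝ) / m - μ g| < δ

/-- The probability that a source which repeatedly emits either a letter (each with weight `a`) or
a block `γ ∈ Λⁿ` (with weight `b * ν γ`) produces exactly the first `k` letters of `ω`. -/
def packWeight {Λ : Type*} (n : ℕ) (ν : (Fin n → Λ) → ℝ) (a b : ℝ) : ℕ → (ℕ → Λ) → ℝ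
  | 0, _ => 1
  | k + 1, ω => a * packWeight n ν a b k ω +
      if 0 < n ∧ n ≤ k + 1 then
        b * ν (fun t => ω (k + 1 - n + t)) * packWeight n ν a b (k + 1 - n) ω
      else 0

section packWeight

variable {Λ : Type*} {n : ℕ} {ν : (Fin n → Λ) → ℝ} {a b : ℝ}

theorem packWeight_congr (k : ℕ) {ω ω' : ℕ → Λ} (h : ∀ t < k, ω t = ω' t) :
    packWeight n ν a b k ω = packWeight n ν a b k ω' := by
  induction k using Nat.strong_induction_on with
  | _ k ih =>
    cases k with
    | zero => simp [packWeight]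
    | succ k =>
      rw [packWeight, packWeight, ih k (by omega) fun t ht => h t (by omega)]
      congr 1
      split_ifs with hc
      · rw [ih (k + 1 - n) (by omega) fun t ht => h t (by omega)]
        congr 3
        funext t
        exact h _ (by omega)
      · rfl

theorem packWeight_nonneg (hν : ∀ γ, 0 ≤ ν γ) (ha : 0 ≤ a) (hb : 0 ≤ b) (k : ℕ) (ω : ℕ → Λ) :
    0 ≤ packWeight n ν a b k ω := by
  induction k using Nat.strong_induction_on with
  | _ k ih =>
    cases k with
    | zero => simp [packWeight]
    | succ k =>
      rw [packWeight]
      have h1 := mul_nonneg ha (ih k (by omega))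
      split_ifs with hc
      · have h2 := mul_nonneg (mul_nonneg hb (hν fun t => ω (k + 1 - n + t)))
          (ih (k + 1 - n) (by omega))
        linarith
      · linarith

theorem le_packWeight (hn : 0 < n) (hν : ∀ γ, 0 ≤ ν γ) (ha : 0 ≤ a) (hb : 0 ≤ b) (ω : ℕ → Λ)
    (i : ℕ → ℕ) (k m : ℕ) (hk : ∀ j < m, i j + n ≤ k)
    (hi : ∀ j₁ j₂, j₁ < j₂ → j₂ < m → i j₁ + n ≤ i j₂) :
    m * n ≤ k ∧ a ^ (k - m * n) * b ^ m * ∏ j ∈ Finset.range m, ν (fun t => ω (i j + t)) ≤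
      packWeight n ν a b k ω := by
  induction k using Nat.strong_induction_on generalizing m with
  | _ k ih =>
    cases k with
    | zero =>
      have hm : m = 0 := by
        by_contra h
        have := hk 0 (by omega)
        omega
      simp [hm, packWeight]
    | succ k =>
      by_cases hlast : ∀ j < m, i j + n ≤ k
      · obtain ⟨h1, h2⟩ := ih k (by omega) m hlast hi
        refine ⟨by omega, ?_⟩
        have h3 := mul_le_mul_of_nonneg_left h2 ha
        rw [packWeight, show k + 1 - m * n = (k - m * n) + 1 by omega, pow_succ]
        split_ifs with hc
        · have h4 := mul_nonneg (mul_nonneg hb (hν fun t => ω (k + 1 - n + t)))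
            (packWeight_nonneg hν ha hb (k + 1 - n) ω)
          nlinarith
        · nlinarith
      · push Not at hlast
        obtain ⟨j, hj, hjk⟩ := hlast
        have hjm : m = j + 1 := by
          by_contra h
          have h1 := hi j (j + 1) (by omega) (by omega)
          have h2 := hk (j + 1) (by omega)
          omega
        subst hjm
        have hj' := hk j hj
        have hij : i j = k + 1 - n := by omega
        obtain ⟨h1, h2⟩ := ih (k + 1 - n) (by omega) j
          (fun j' hj' => hij ▸ hi j' j hj' (by omega))
          (fun j₁ j₂ h h' => hi j₁ j₂ h (by omega))
        have hle : (j + 1) * n ≤ k + 1 := by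
          rw [Nat.succ_mul]
          omega
        refine ⟨hle, ?_⟩
        have h3 := mul_le_mul_of_nonneg_left h2
          (mul_nonneg hb (hν fun t => ω (k + 1 - n + t)))
        have h4 := mul_nonneg ha (packWeight_nonneg hν ha hb k ω)
        rw [packWeight, if_pos ⟨hn, by omega⟩, Finset.prod_range_succ, hij,
          show k + 1 - (j + 1) * n = k + 1 - n - j * n by rw [Nat.succ_mul]; omega, pow_succ]
        nlinarith

/-- A finite word continued by the constant letter `d`. -/
def extendWord (d : Λ) {k : ℕ} (ω : Fin k → Λ) (t : ℕ) : Λ :=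
  if h : t < k then ω ⟨t, h⟩ else d

theorem extendWord_append_left (d : Λ) {k l : ℕ} (u : Fin k → Λ) (v : Fin l → Λ) {t : ℕ}
    (ht : t < k) : extendWord d (Fin.append u v) t = extendWord d u t := by
  have h : t < k + l := by omega
  simp only [extendWord, ht, h, dif_pos]
  exact Fin.append_left u v ⟨t, ht⟩

theorem extendWord_append_right (d : Λ) {k l : ℕ} (u : Fin k → Λ) (v : Fin l → Λ) (t : Fin l) :
    extendWord d (Fin.append u v) (k + t) = v t := by
  have h : k + (t : ℕ) < k + l := by omega
  simp only [extendWord, h, dif_pos]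
  exact Fin.append_right u v t

theorem sum_packWeight_mul [Fintype Λ] (d : Λ) (k l : ℕ) (g : (Fin l → Λ) → ℝ) :
    ∑ ω : Fin (k + l) → Λ,
        g (fun t => extendWord d ω (k + t)) * packWeight n ν a b k (extendWord d ω) =
      (∑ v, g v) * ∑ u : Fin k → Λ, packWeight n ν a b k (extendWord d u) := by
  rw [← (Fin.appendEquiv k l).sum_comp, Fintype.sum_prod_type_right, Finset.sum_mul_sum]
  refine Finset.sum_congr rfl fun v _ => Finset.sum_congr rfl fun u _ => ?_
  simp only [Fin.appendEquiv, Equiv.coe_fn_mk, extendWord_append_right]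
  rw [packWeight_congr k fun t ht => extendWord_append_left d u v ht]

theorem sum_packWeight_le_one [Fintype Λ] (d : Λ) (hν : ∑ γ, ν γ = 1)
    (ha : 0 ≤ a) (hb : 0 ≤ b) (hab : Fintype.card Λ * a + b ≤ 1) (k : ℕ) :
    ∑ ω : Fin k → Λ, packWeight n ν a b k (extendWord d ω) ≤ 1 := by
  induction k using Nat.strong_induction_on with
  | _ k ih =>
    cases k with
    | zero => simp [packWeight]
    | succ k =>
      have hletter := sum_packWeight_mul (n := n) (ν := ν) (a := a) (b := b) d k 1 fun _ => a
      simp only [Finset.sum_const, Finset.card_univ, Fintype.card_fun, Fintype.card_fin, pow_one,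
        nsmul_eq_mul] at hletter
      have hca : (0 : ℝ) ≤ Fintype.card Λ * a := by positivity
      have h1 := mul_le_mul_of_nonneg_left (ih k (by omega)) hca
      simp only [packWeight, Finset.sum_add_distrib]
      rw [hletter]
      by_cases hc : 0 < n ∧ n ≤ k + 1
      · simp only [hc, and_self, if_true]
        obtain ⟨l, hl⟩ : ∃ l, k + 1 = l + n := ⟨k + 1 - n, by omega⟩
        have hblock := sum_packWeight_mul (n := n) (ν := ν) (a := a) (b := b) d l n fun v => b * ν v
        rw [← Finset.mul_sum, hν] at hblock
        have h2 := mul_le_mul_of_nonneg_left (ih l (by omega)) hb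
        have hsub : k + 1 - n = l := by omega
        rw [hsub, hl, hblock]
        linarith
      · simp only [hc, if_false, Finset.sum_const_zero]
        linarith

end packWeight

/-- If every word in a class carries at least the weight `c`, the class has at most `1 / c`
members. -/
theorem card_mul_le_one_of_le_packWeight {Λ : Type*} [Fintype Λ] {n : ℕ} {ν : (Fin n → Λ) → ℝ}
    {a b c : ℝ} (d : Λ) (hν0 : ∀ γ, 0 ≤ ν γ) (hν : ∑ γ, ν γ = 1) (ha : 0 ≤ a) (hb : 0 ≤ b)
    (hab : Fintype.card Λ * a + b ≤ 1) (k : ℕ) (p : (Fin k → Λ) → Prop)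
    (hp : ∀ ω, p ω → c ≤ packWeight n ν a b k (extendWord d ω)) :
    (Nat.card {ω // p ω} : ℝ) * c ≤ 1 := by
  classical
  rw [Nat.card_eq_fintype_card, Fintype.card_subtype, ← nsmul_eq_mul]
  refine (Finset.card_nsmul_le_sum _ _ c fun ω hω => hp ω (by simpa using hω)).trans ?_
  refine le_trans ?_ (sum_packWeight_le_one (k := k) d hν ha hb hab)
  exact Finset.sum_le_sum_of_subset_of_nonneg (Finset.subset_univ _)
    fun ω _ _ => packWeight_nonneg hν0 ha hb _ _

/-- A lower bound for the log-likelihood under `ν` of a sequence whose empirical distribution is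
`δ`-close to `μ`. -/
theorem sum_log_ge_of_empirical_close {Γ : Type*} [Fintype Γ] {μ ν : Γ → ℝ} {δ : ℝ} {m : ℕ}
    (hm : 0 < m) (γ : Fin m → Γ) (hν0 : ∀ g, 0 < ν g) (hν1 : ∀ g, ν g ≤ 1)
    (h : ∀ g, |(Nat.card {j : Fin m // γ j = g} : ℝ) / m - μ g| < δ) :
    m * ∑ g, (μ g + δ) * Real.log (ν g) ≤ ∑ j, Real.log (ν (γ j)) := by
  classical
  have hm' : (0 : ℝ) < m := by exact_mod_cast hm
  rw [← Finset.sum_fiberwise' Finset.univ γ fun g => Real.log (ν g), Finset.mul_sum]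
  refine Finset.sum_le_sum fun g _ => ?_
  have hg := (abs_lt.1 (h g)).2
  rw [Nat.card_eq_fintype_card, Fintype.card_subtype, sub_lt_iff_lt_add, div_lt_iff₀ hm'] at hg
  have hlog : Real.log (ν g) ≤ 0 := Real.log_nonpos (hν0 g).le (hν1 g)
  rw [Finset.sum_const, nsmul_eq_mul]
  nlinarith

/-- The exponential rate, in nats per letter, of the bound obtained from `packWeight` with letter
weight `δ / M` and block distribution `(μ + δ) / (1 + δ |Γ|)`. -/
noncomputable def packRate {Γ : Type*} [Fintype Γ] (n M : ℕ) (μ : Γ → ℝ) (δ : ℝ) : ℝ :=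
  -(1 / n) * ∑ g, ((μ g + δ) * Real.log (μ g + δ) -
    (μ g + δ) * Real.log (1 + δ * Fintype.card Γ)) -
  (δ * Real.log δ - δ * Real.log M) - Real.log (1 - δ)

theorem tendsto_packRate {Γ : Type*} [Fintype Γ] (n M : ℕ) (μ : Γ → ℝ) :
    Tendsto (packRate n M μ) (𝓝 0) (𝓝 (-(1 / n) * ∑ g, μ g * Real.log (μ g))) := by
  have h : ContinuousAt (packRate n M μ) 0 := by
    unfold packRate
    have h1 : ∀ x : ℝ, ContinuousAt (fun δ : ℝ => (x + δ) * Real.log (x + δ)) 0 := fun x =>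
      (Real.continuous_mul_log.comp (continuous_const.add continuous_id)).continuousAt
    have h2 : ContinuousAt (fun δ : ℝ => Real.log (1 + δ * Fintype.card Γ)) 0 :=
      ContinuousAt.log (by fun_prop) (by simp)
    have h3 : ContinuousAt (fun δ : ℝ => δ * Real.log δ) 0 :=
      Real.continuous_mul_log.continuousAt
    have h4 : ContinuousAt (fun δ : ℝ => Real.log (1 - δ)) 0 :=
      ContinuousAt.log (by fun_prop) (by simp)
    fun_prop
  simpa [ContinuousAt, packRate] using h

theorem exp_neg_packRate_le_packWeight {Λ : Type*} [Fintype Λ] [Nonempty Λ] {n k : ℕ}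
    (hn : 1 ≤ n) (hk : n < k) {μ : (Fin n → Λ) → ℝ} (hμ0 : ∀ γ, 0 ≤ μ γ) (hμ1 : ∀ γ, μ γ ≤ 1)
    {δ : ℝ} (hδ : 0 < δ) (hδ2 : δ < 1 / 2) (d : Λ) {ω : Fin k → Λ}
    (hω : IsPackedWord Λ n k δ μ ω) :
    Real.exp (-(k * packRate n (Fintype.card Λ) μ δ)) ≤
      packWeight n (fun g => (μ g + δ) / (1 + δ * Fintype.card (Fin n → Λ)))
        (δ / Fintype.card Λ) (1 - δ) k (extendWord d ω) := by
  obtain ⟨m, i, γ, hik, hi, hmk, hγ, hclose⟩ := hω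
  set G : ℝ := (Fintype.card (Fin n → Λ) : ℝ) with hG
  set ν : (Fin n → Λ) → ℝ := fun g => (μ g + δ) / (1 + δ * G) with hν
  have hG1 : (1 : ℝ) ≤ G := Nat.one_le_cast.2 Fintype.card_pos
  have hM1 : (1 : ℝ) ≤ Fintype.card Λ := Nat.one_le_cast.2 Fintype.card_pos
  have hden : 0 < 1 + δ * G := by positivity
  have hν0 : ∀ g, 0 < ν g := fun g => div_pos (by linarith [hμ0 g]) hden
  have hν1 : ∀ g, ν g ≤ 1 := fun g => (div_le_one hden).2 (by nlinarith [hμ1 g])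
  have hk0 : (0 : ℝ) < k := by exact_mod_cast (by omega : 0 < k)
  have hn0 : (0 : ℝ) < n := by exact_mod_cast hn
  have hm : 0 < m := by
    rcases Nat.eq_zero_or_pos m with rfl | h
    · norm_num at hmk
      linarith
    · exact h
  have ha : 0 < δ / (Fintype.card Λ : ℝ) := by positivity
  have hb : 0 < 1 - δ := by linarith
  obtain ⟨hmn, hle⟩ := le_packWeight (ν := ν) hn (fun g => (hν0 g).le) ha.le hb.le
    (extendWord d ω) (fun j => if h : j < m then i ⟨j, h⟩ else 0) k m
    (fun j hj => by
      have := hik ⟨j, hj⟩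
      simp only [hj, dif_pos]
      omega)
    (fun j₁ j₂ h12 h2 => by
      have := hi ⟨j₁, by omega⟩ ⟨j₂, h2⟩ h12
      simpa only [h2, h12.trans h2, dif_pos] using this)
  have hblocks : ∏ j ∈ Finset.range m,
      ν (fun t => extendWord d ω ((if h : j < m then i ⟨j, h⟩ else 0) + t)) = ∏ j, ν (γ j) := by
    rw [Finset.prod_range]
    refine Finset.prod_congr rfl fun j _ => congrArg ν (funext fun t => ?_)
    have hjk := hik j
    have hlt : i j + (t : ℕ) < k := by omega
    simp only [j.2, dif_pos, extendWord, hlt]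
    exact hγ j t t.2 hlt
  rw [hblocks] at hle
  refine le_trans ?_ hle
  have hprod : 0 < ∏ j, ν (γ j) := Finset.prod_pos fun j _ => hν0 _
  rw [← Real.le_log_iff_exp_le (by positivity), Real.log_mul (by positivity) hprod.ne',
    Real.log_mul (by positivity) (by positivity), Real.log_pow, Real.log_pow,
    Real.log_prod fun j _ => (hν0 _).ne', Nat.cast_sub hmn, Nat.cast_mul]
  have hsum := sum_log_ge_of_empirical_close hm γ hν0 hν1 hclose
  have hmn' : (m : ℝ) * n ≤ k := by exact_mod_cast hmn
  have hmk' : (m : ℝ) ≤ k := by exact_mod_cast (Nat.le_mul_of_pos_right m hn).trans hmn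
  have hL : ∑ g, (μ g + δ) * Real.log (ν g) ≤ 0 := Finset.sum_nonpos fun g _ =>
    mul_nonpos_of_nonneg_of_nonpos (by linarith [hμ0 g]) (Real.log_nonpos (hν0 g).le (hν1 g))
  have hLeq : ∑ g, (μ g + δ) * Real.log (ν g) = ∑ g, ((μ g + δ) * Real.log (μ g + δ) -
      (μ g + δ) * Real.log (1 + δ * G)) := by
    refine Finset.sum_congr rfl fun g _ => ?_
    rw [hν, Real.log_div (by linarith [hμ0 g]) hden.ne', mul_sub]
  have hloga : Real.log (δ / Fintype.card Λ) = Real.log δ - Real.log (Fintype.card Λ) :=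
    Real.log_div hδ.ne' (by positivity)
  have hloga0 : Real.log (δ / Fintype.card Λ) ≤ 0 :=
    Real.log_nonpos ha.le ((div_le_one (by positivity)).2 (by linarith))
  have hlogb0 : Real.log (1 - δ) ≤ 0 := Real.log_nonpos hb.le (by linarith)
  have hspare : (k : ℝ) - m * n ≤ δ * k := by
    rw [lt_div_iff₀ hk0] at hmk
    linarith
  have hletters := mul_le_mul_of_nonpos_right hspare hloga0
  have hchoices := mul_le_mul_of_nonpos_right hmk' hlogb0
  have hcontent := mul_le_mul_of_nonpos_right ((le_div_iff₀ hn0).2 hmn') hL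
  rw [packRate, ← hG, ← hLeq]
  have hexpand : -((k : ℝ) * (-(1 / n) * ∑ g, (μ g + δ) * Real.log (ν g) -
      (δ * Real.log δ - δ * Real.log (Fintype.card Λ)) - Real.log (1 - δ))) =
      δ * k * Real.log (δ / Fintype.card Λ) + k * Real.log (1 - δ) +
        k / n * ∑ g, (μ g + δ) * Real.log (ν g) := by
    rw [hloga]
    ring
  rw [hexpand]
  linarith

/-- Let `Λ` be an alphabet of `M` letters, `Γ = Λⁿ` and `μ` a
probability distribution on `Γ` with average entropy
`h₀ = −(1/n)·∑_γ μ(γ)·log₂ μ(γ)`. There is a positive function `φ(δ) → 0` as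
`δ → 0` such that for every `0 < δ < 1/2` and `k > n` the number of words
`ω ∈ Λ^k` that are `(n, k, δ, μ)` is at most `2^{k(h₀ + φ(δ))}`. -/
theorem count_packed_words_le {Λ : Type*} [Fintype Λ] (M : ℕ) (hM : Fintype.card Λ = M)
    (n : ℕ) (hn : 1 ≤ n) (μ : (Fin n → Λ) → ℝ)
    (hμ0 : ∀ γ, 0 ≤ μ γ) (hμ1 : ∑ γ, μ γ = 1)
    (h₀ : ℝ) (hh₀ : h₀ = -(1 / n) * ∑ γ, μ γ * Real.logb 2 (μ γ)) :
    ∃ φ : ℝ → ℝ, (∀ δ : ℝ, 0 < δ → 0 < φ δ) ∧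
      Tendsto φ (𝓝[>] (0 : ℝ)) (𝓝 0) ∧
      ∀ δ : ℝ, 0 < δ → δ < 1 / 2 → ∀ k : ℕ, n < k →
        (Nat.card {ω : Fin k → Λ // IsPackedWord Λ n k δ μ ω} : ℝ)
          ≤ (2 : ℝ) ^ ((k : ℝ) * (h₀ + φ δ)) := by
  classical
  have hlog2 : 0 < Real.log 2 := Real.log_pos one_lt_two
  have hh : h₀ = -(1 / n) * (∑ γ, μ γ * Real.log (μ γ)) / Real.log 2 := by
    simp only [hh₀, Real.logb, mul_div_assoc, Finset.sum_div]
  refine ⟨fun δ => |packRate n M μ δ / Real.log 2 - h₀| + δ, fun δ hδ => by positivity, ?_, ?_⟩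
  · have h := (((tendsto_packRate n M μ).div_const (Real.log 2)).sub_const h₀).abs.add tendsto_id
    rw [← hh, sub_self, abs_zero, add_zero] at h
    exact h.mono_left nhdsWithin_le_nhds
  · intro δ hδ hδ2 k hk
    subst hM
    have hne : Nonempty Λ := by
      by_contra hempty
      rw [not_nonempty_iff] at hempty
      have : Nonempty (Fin n) := ⟨⟨0, hn⟩⟩
      simp at hμ1
    obtain ⟨d⟩ := hne
    have : Nonempty Λ := ⟨d⟩
    have hμle : ∀ γ, μ γ ≤ 1 := fun γ =>
      hμ1 ▸ Finset.single_le_sum (fun γ _ => hμ0 γ) (Finset.mem_univ γ)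
    have hM0 : (Fintype.card Λ : ℝ) ≠ 0 := by exact_mod_cast Fintype.card_ne_zero
    have hden : 0 < 1 + δ * (Fintype.card (Fin n → Λ) : ℝ) := by positivity
    have hcount := card_mul_le_one_of_le_packWeight d
      (fun g => (div_pos (by linarith [hμ0 g]) hden).le)
      (by
        rw [← Finset.sum_div, Finset.sum_add_distrib, hμ1, Finset.sum_const, Finset.card_univ,
          nsmul_eq_mul, mul_comm, div_self hden.ne'])
      (by positivity) (by linarith) (by rw [mul_div_cancel₀ _ hM0]; linarith) k _
      fun ω hω => exp_neg_packRate_le_packWeight hn hk hμ0 hμle hδ hδ2 d hω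
    rw [Real.exp_neg, ← div_eq_mul_inv, div_le_one (Real.exp_pos _)] at hcount
    refine hcount.trans ?_
    rw [Real.rpow_def_of_pos two_pos, Real.exp_le_exp, mul_left_comm]
    refine mul_le_mul_of_nonneg_left ?_ k.cast_nonneg
    have hle := le_abs_self (packRate n (Fintype.card Λ) μ δ / Real.log 2 - h₀)
    rw [mul_comm, ← div_le_iff₀ hlog2]
    linarith
end
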